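/- Let α, μ be real and k an integer with k ≠ 1. Let τ ∈ ℂ with Re τ > 0, q := e^{−2πτ}, q̂ := e^{−2π/τ}. Then e(αμ)·( ψ(k,−μ,α) + 𝒮_k(0,−μ;0,α;q) + (−1)^{k−1}·𝒮_k(0,μ;0,−α;q) ) − (−2π)^k·Σ_{j=0}^{k+1} ((−i)^j·𝒞_j(⟨α⟩,μ)·B_{k+1−j}/(j!(k+1−j)!))·τ^{k−j} = (−iτ)^{k−1}·( δ(α)·ζ(k) + 𝒮_k(α,0;μ,0;q̂) + (−1)^{k−1}·𝒮_k(−α,0;−μ,0;q̂) ), where B_j denotes the j-th Bernoulli number and the j-sum is empty when k+1 < 0. -/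

import Mathlib

noncomputable section

open Complex MeasureTheory
open scoped Real Classical

/-- `e(s) = exp(2 π i s)`. -/
def ee (s : ℂ) : ℂ := Complex.exp (2 * (Real.pi : ℂ) * Complex.I * s)

/-- `δ(x) = 1` if `x ∈ ℤ`, `0` otherwise. -/
def dInt (x : ℝ) : ℂ := if ∃ n : ℤ, (n : ℝ) = x then 1 else 0

/-- The Lerch zeta function `ψ(r,γ,κ) = Σ_{k ∈ ℤ, γ+k>0} e((γ+k)κ) (γ+k)^{-r}`
(a convergent series when `Re r > 1`). -/
def psiL (r : ℂ) (γ κ : ℝ) : ℂ :=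
  ∑' k : {k : ℤ // 0 < γ + (k : ℝ)},
    ee ((((γ + (k.1 : ℝ)) * κ : ℝ)) : ℂ) * (((γ + (k.1 : ℝ)) : ℝ) : ℂ) ^ (-r)

/-- The `q`-series `𝒮_r(γ,δ;κ,λ;q)`, where `q = e^{-2πt}` with `Re t > 0`, and the power
`q^{(γ+k)(δ+l)}` is interpreted as `exp (-2πt(γ+k)(δ+l))`. -/
def Scal (r : ℂ) (γ δ' κ lam : ℝ) (t : ℂ) : ℂ :=
  ∑' (k : {k : ℤ // 0 < γ + (k : ℝ)}) (l : {l : ℤ // 0 < δ' + (l : ℝ)}),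
    ee ((((γ + (k.1 : ℝ)) * κ + (δ' + (l.1 : ℝ)) * lam : ℝ)) : ℂ) *
      (((δ' + (l.1 : ℝ)) : ℝ) : ℂ) ^ (-r) *
      Complex.exp (-2 * (Real.pi : ℂ) * t * ((γ + (k.1 : ℝ) : ℝ) : ℂ) * ((δ' + (l.1 : ℝ) : ℝ) : ℂ))

/-- The generalized Eisenstein series `F_{ℤ²}(s;α,β;μ,ν;z)` (mean of the two branch
conventions), defined by an absolutely convergent series for `Re s > 2`. -/
def Fz2 (s : ℂ) (α β μ ν : ℝ) (z : ℂ) : ℂ :=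
  (∑' p : {p : ℤ × ℤ // β + (p.2 : ℝ) ≠ 0},
      ee ((((α + (p.1.1 : ℝ)) * μ + (β + (p.1.2 : ℝ)) * ν : ℝ)) : ℂ) *
        ((((α + (p.1.1 : ℝ)) : ℝ) : ℂ) + (((β + (p.1.2 : ℝ)) : ℝ) : ℂ) * z) ^ (-s)) +
  dInt β *
    ((∑' m : {m : ℤ // 0 < α + (m : ℝ)},
        ee ((((α + (m.1 : ℝ)) * μ : ℝ)) : ℂ) * (((α + (m.1 : ℝ)) : ℝ) : ℂ) ^ (-s)) +
      Complex.cos ((Real.pi : ℂ) * s) *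
        ∑' m : {m : ℤ // α + (m : ℝ) < 0},
          ee ((((α + (m.1 : ℝ)) * μ : ℝ)) : ℂ) * ((|α + (m.1 : ℝ)| : ℝ) : ℂ) ^ (-s))

/-- `𝒜(s,α,μ) = cos(πs) ψ(s,-α,-μ) + ψ(s,α,μ)`. -/
def Acal (s : ℂ) (α μ : ℝ) : ℂ :=
  Complex.cos ((Real.pi : ℂ) * s) * psiL s (-α) (-μ) + psiL s α μ

/-- `ψ(k,γ,κ)` at an integer `k`: the convergent series for `k ≥ 2`, the value
`-𝒞_{1-k}(⟨γ⟩,κ)/(1-k) - δ_{k0} δ(γ)` of the analytic continuation for `k ≤ 0`,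
and the (irrelevant) value `0` for `k = 1`; here `C` is the family of Taylor
coefficients `𝒞`. -/
def psiIntC (C : ℕ → ℂ → ℝ → ℂ) (k : ℤ) (γ κ : ℝ) : ℂ :=
  if 2 ≤ k then
    ∑' n : {n : ℤ // 0 < γ + (n : ℝ)},
      ee ((((γ + (n.1 : ℝ)) * κ : ℝ)) : ℂ) * (((γ + (n.1 : ℝ)) : ℝ) : ℂ) ^ (-k)
  else if k ≤ 0 then
    -C (1 - k).toNat ((Int.fract γ : ℝ) : ℂ) κ / ((1 : ℂ) - (k : ℂ)) -
      (if k = 0 then dInt γ else 0)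
  else 0

/-- The Bernoulli polynomial `B_j(x)` evaluated in `ℂ`. -/
def BpolyC (j : ℕ) (x : ℂ) : ℂ := Polynomial.aeval x (Polynomial.bernoulli j)

/-- Weierstrass `℘`-function with periods `(1, z)`. -/
def wpFn (z w : ℂ) : ℂ :=
  w ^ (-2 : ℤ) + ∑' p : {p : ℤ × ℤ // p ≠ (0, 0)},
    ((w - (p.1.1 : ℂ) - (p.1.2 : ℂ) * z) ^ (-2 : ℤ) -
      ((p.1.1 : ℂ) + (p.1.2 : ℂ) * z) ^ (-2 : ℤ))

/-- Weierstrass zeta function with periods `(1, z)`. -/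
def wzetaFn (z w : ℂ) : ℂ :=
  1 / w + ∑' p : {p : ℤ × ℤ // p ≠ (0, 0)},
    (1 / (w - (p.1.1 : ℂ) - (p.1.2 : ℂ) * z) + 1 / ((p.1.1 : ℂ) + (p.1.2 : ℂ) * z) +
      w / ((p.1.1 : ℂ) + (p.1.2 : ℂ) * z) ^ 2)

/-- Weierstrass sigma function with periods `(1, z)`. -/
def wsigmaFn (z w : ℂ) : ℂ :=
  w * ∏' p : {p : ℤ × ℤ // p ≠ (0, 0)},
    ((1 - w / ((p.1.1 : ℂ) + (p.1.2 : ℂ) * z)) *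
      Complex.exp (w / ((p.1.1 : ℂ) + (p.1.2 : ℂ) * z) +
        w ^ 2 / (2 * ((p.1.1 : ℂ) + (p.1.2 : ℂ) * z) ^ 2)))

/-- The `q`-Pochhammer symbol `(Z;q)_∞`. -/
def qPoch (Z q : ℂ) : ℂ := ∏' l : ℕ, (1 - Z * q ^ l)

/-- `⟨x⟩' = 1 - ⟨-x⟩`. -/
def fracP (x : ℝ) : ℝ := 1 - Int.fract (-x)

/-- The Eisenstein series `E₂`. -/
def E2cl (z : ℂ) : ℂ := 1 - 24 * ∑' l : ℕ+, (l : ℂ) * ee z ^ (l : ℕ) / (1 - ee z ^ (l : ℕ))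

/-- `a_{2k}`: `ζ(1-2k)` for `k ≠ 0` and `2ζ'(0) = -log 2π` for `k = 0`. -/
def acoef (k : ℤ) : ℂ :=
  if k = 0 then -(Real.log (2 * Real.pi) : ℂ) else riemannZeta ((1 - 2 * k : ℤ) : ℂ)

/-- The classical Eisenstein series `E_{2k}`. -/
def Ecl (k : ℤ) (z : ℂ) : ℂ :=
  1 + (2 / acoef k) * ∑' l : ℕ+, (l : ℂ) ^ (2 * k - 1) * ee z ^ (l : ℕ) / (1 - ee z ^ (l : ℕ))

/-- The bilateral Lerch zeta function `ψ_ℤ^ε(r,γ,κ) = e^{-επir} ψ(r,-γ,-κ) + ψ(r,γ,κ)`. -/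
def psiZpm (ε : ℤ) (r : ℂ) (γ κ : ℝ) : ℂ :=
  Complex.exp (-(ε : ℂ) * (Real.pi : ℂ) * Complex.I * r) * psiL r (-γ) (-κ) + psiL r γ κ

open Filter Topology

lemma ee_add (a b : ℂ) : ee (a + b) = ee a * ee b := by
  simp only [ee, ← Complex.exp_add]; ring_nf

lemma ee_zero : ee 0 = 1 := by simp [ee]

lemma ee_ne_zero (a : ℂ) : ee a ≠ 0 := Complex.exp_ne_zero _

lemma ee_neg (a : ℂ) : ee (-a) = (ee a)⁻¹ := by
  simp only [ee, ← Complex.exp_neg]; ring_nf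

lemma ee_intCast (n : ℤ) : ee n = 1 := by
  rw [ee, Complex.exp_eq_one_iff]; exact ⟨n, by ring⟩

lemma ee_add_intCast (a : ℂ) (n : ℤ) : ee (a + n) = ee a := by
  rw [ee_add, ee_intCast, mul_one]

lemma ee_sub_intCast (a : ℂ) (n : ℤ) : ee (a - n) = ee a := by
  have := ee_add_intCast a (-n)
  rwa [Int.cast_neg, ← sub_eq_add_neg] at this

lemma ee_eq_one_iff (a : ℂ) : ee a = 1 ↔ ∃ n : ℤ, a = n := by
  rw [ee, Complex.exp_eq_one_iff]
  refine exists_congr fun n => ?_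
  have h : 2 * (π : ℂ) * I ≠ 0 := Complex.two_pi_I_ne_zero
  rw [mul_comm (n : ℂ), mul_right_inj' h]

lemma norm_ee (a : ℂ) : ‖ee a‖ = Real.exp (-2 * π * a.im) := by
  rw [ee, Complex.norm_exp]; congr 1; simp

lemma norm_ee_ofReal (a : ℝ) : ‖ee (a : ℂ)‖ = 1 := by
  rw [norm_ee]; simp

lemma ee_natCast_mul (n : ℕ) (a : ℂ) : ee (n * a) = ee a ^ n := by
  rw [ee, ee, ← Complex.exp_nat_mul]; ring_nf

/-- The integrality condition of `dInt` in terms of `ee`. -/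
lemma dInt_eq_ite (x : ℝ) : dInt x = if ee (x : ℂ) = 1 then 1 else 0 := by
  rw [dInt]
  refine if_congr ?_ rfl rfl
  rw [ee_eq_one_iff]
  refine exists_congr fun n => ?_
  rw [eq_comm]; norm_cast

lemma fracP_pos (x : ℝ) : 0 < fracP x := by
  have := Int.fract_lt_one (-x); rw [fracP]; linarith

lemma fracP_eq_add_intCast (x : ℝ) : fracP x = x + ((1 + ⌊-x⌋ : ℤ) : ℝ) := by
  rw [fracP, Int.fract]; push_cast; ring

lemma fracP_zero : fracP 0 = 1 := by simp [fracP]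

lemma fract_neg_eq_one_sub_fracP (x : ℝ) : Int.fract (-x) = 1 - fracP x := by
  rw [fracP]; ring

/-- The numbers `n + γ > 0`, `n ∈ ℤ`, enumerated as `fracP γ + i`, `i ∈ ℕ`. -/
def posTranslateEquiv (γ : ℝ) : ℕ ≃ {n : ℤ // 0 < γ + (n : ℝ)} where
  toFun i := ⟨1 + ⌊-γ⌋ + i, by
    have h := fracP_eq_add_intCast γ
    have := fracP_pos γ
    push_cast at h ⊢
    have : (0 : ℝ) ≤ i := Nat.cast_nonneg i
    linarith⟩
  invFun n := (n.1 - (1 + ⌊-γ⌋)).toNat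
  left_inv i := by simp
  right_inv n := by
    apply Subtype.ext
    have h1 : ⌊-γ⌋ < n.1 := by
      rw [Int.floor_lt]; linarith [n.2]
    simp only
    rw [Int.toNat_of_nonneg (by linarith)]
    ring

lemma posTranslateEquiv_apply (γ : ℝ) (i : ℕ) :
    γ + ((posTranslateEquiv γ i).1 : ℝ) = fracP γ + i := by
  rw [fracP_eq_add_intCast]
  simp only [posTranslateEquiv, Equiv.coe_fn_mk]
  push_cast; ring

lemma tsum_posTranslate (γ : ℝ) (F : ℝ → ℂ) :
    ∑' n : {n : ℤ // 0 < γ + (n : ℝ)}, F (γ + (n.1 : ℝ)) = ∑' i : ℕ, F (fracP γ + i) := by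
  rw [← (posTranslateEquiv γ).tsum_eq]
  simp only [posTranslateEquiv_apply]

lemma Scal_eq_tsum_nat (k : ℤ) (γ δ' κ lam : ℝ) (t : ℂ) :
    Scal (k : ℂ) γ δ' κ lam t = ∑' (i : ℕ) (j : ℕ),
      ee (((fracP γ + i) * κ + (fracP δ' + j) * lam : ℝ) : ℂ) *
        ((fracP δ' + j : ℝ) : ℂ) ^ (-k) *
        Complex.exp (-2 * (π : ℂ) * t * ((fracP γ + i : ℝ) : ℂ) * ((fracP δ' + j : ℝ) : ℂ)) := by
  rw [Scal, tsum_posTranslate γ (fun y => ∑' l : {l : ℤ // 0 < δ' + (l : ℝ)},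
    ee ((y * κ + (δ' + (l.1 : ℝ)) * lam : ℝ) : ℂ) *
      (((δ' + (l.1 : ℝ)) : ℝ) : ℂ) ^ (-(k : ℂ)) *
      Complex.exp (-2 * (π : ℂ) * t * (y : ℂ) * ((δ' + (l.1 : ℝ) : ℝ) : ℂ)))]
  refine tsum_congr fun i => ?_
  rw [tsum_posTranslate δ' (fun x => ee (((fracP γ + i) * κ + x * lam : ℝ) : ℂ) *
      (x : ℂ) ^ (-(k : ℂ)) *
      Complex.exp (-2 * (π : ℂ) * t * ((fracP γ + i : ℝ) : ℂ) * (x : ℂ)))]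
  refine tsum_congr fun j => ?_
  rw [← Int.cast_neg, Complex.cpow_intCast]

/-- Summability of the absolute values of the double series behind `Scal`, with room for an
extra exponential factor. -/
lemma summable_exp_bilinear {a b c ρ : ℝ} (hb : 0 < b) (hc : 0 < c) (hρ : ρ < c * a) :
    Summable fun p : ℕ × ℕ => Real.exp (-c * (a + p.1) * (b + p.2) + ρ * (b + p.2)) := by
  have h1 : Summable fun i : ℕ => Real.exp (-(c * b)) ^ i :=
    summable_geometric_of_lt_one (Real.exp_nonneg _)
      (by rw [Real.exp_lt_one_iff]; nlinarith [mul_pos hc hb])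
  have h2 : Summable fun j : ℕ => Real.exp (-(c * a - ρ)) ^ j :=
    summable_geometric_of_lt_one (Real.exp_nonneg _)
      (by rw [Real.exp_lt_one_iff]; linarith)
  have h3 := (h1.mul_of_nonneg h2 (fun _ => pow_nonneg (Real.exp_nonneg _) _)
    (fun _ => pow_nonneg (Real.exp_nonneg _) _)).mul_left (Real.exp (-(c * a * b) + ρ * b))
  refine Summable.of_nonneg_of_le (fun _ => Real.exp_nonneg _) (fun p => ?_) h3
  rw [← Real.exp_nat_mul, ← Real.exp_nat_mul, ← Real.exp_add, ← Real.exp_add, Real.exp_le_exp]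
  have : 0 ≤ c * ((p.1 : ℝ) * (p.2 : ℝ)) := by positivity
  nlinarith

/-- The power series `p` converges to `f` in a punctured neighbourhood of `0`. -/
def PunctHasSum (p : PowerSeries ℂ) (f : ℂ → ℂ) : Prop :=
  ∀ᶠ Z in 𝓝[≠] (0 : ℂ), HasSum (fun j : ℕ => PowerSeries.coeff j p * Z ^ j) (f Z)

namespace PunctHasSum

variable {p q : PowerSeries ℂ} {f g : ℂ → ℂ}

lemma eq_zero (h : PunctHasSum p 0) : p = 0 := by
  set F : ℂ → ℂ := fun z => if z = 0 then PowerSeries.coeff 0 p else 0 with hF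
  have hs : HasFPowerSeriesAt F
      (FormalMultilinearSeries.ofScalars ℂ (fun n => PowerSeries.coeff n p)) 0 := by
    rw [hasFPowerSeriesAt_iff]
    have h' := eventually_nhdsWithin_iff.mp h
    filter_upwards [h'] with z hz
    simp only [FormalMultilinearSeries.coeff_ofScalars, smul_eq_mul, zero_add]
    by_cases hz0 : z = 0
    · subst hz0
      simp only [hF, if_true]
      have := hasSum_single (f := fun n : ℕ => (0 : ℂ) ^ n * PowerSeries.coeff n p) 0
        (fun n hn => by simp [hn])
      simpa using this
    · simpa [hF, hz0, mul_comm] using hz hz0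
  have h0 : F 0 = 0 := by
    have hc : Tendsto F (𝓝[≠] 0) (𝓝 (F 0)) := hs.continuousAt.tendsto.mono_left nhdsWithin_le_nhds
    have hc' : Tendsto F (𝓝[≠] 0) (𝓝 0) := by
      refine tendsto_const_nhds.congr' ?_
      filter_upwards [self_mem_nhdsWithin] with z hz
      have hz' : z ≠ 0 := hz
      simp [hF, hz']
    exact tendsto_nhds_unique hc hc'
  have hF0 : F = 0 := by
    funext z
    by_cases hz : z = 0
    · subst hz; exact h0
    · simp [hF, hz]
  rw [hF0] at hs
  have := hs.eq_zero
  ext n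
  have h2 := congrArg (fun s => FormalMultilinearSeries.coeff s n) this
  rw [FormalMultilinearSeries.coeff_ofScalars] at h2
  rw [h2]
  simp [FormalMultilinearSeries.coeff]

lemma congr (h : PunctHasSum p f) (hfg : f =ᶠ[𝓝[≠] 0] g) : PunctHasSum p g := by
  filter_upwards [h, hfg] with z h1 h2
  rwa [← h2]

lemma sub (hp : PunctHasSum p f) (hq : PunctHasSum q g) : PunctHasSum (p - q) (f - g) := by
  filter_upwards [hp, hq] with z h1 h2
  simpa [sub_mul] using h1.sub h2

lemma add (hp : PunctHasSum p f) (hq : PunctHasSum q g) : PunctHasSum (p + q) (f + g) := by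
  filter_upwards [hp, hq] with z h1 h2
  simpa [add_mul] using h1.add h2

lemma unique (hp : PunctHasSum p f) (hq : PunctHasSum q f) : p = q := by
  have := hp.sub hq
  rw [sub_self] at this
  exact sub_eq_zero.mp this.eq_zero

lemma mul (hp : PunctHasSum p f) (hq : PunctHasSum q g) : PunctHasSum (p * q) (f * g) := by
  filter_upwards [hp, hq] with z h1 h2
  have h1' := h1.summable.norm
  have h2' := h2.summable.norm
  have h3 := summable_norm_sum_mul_antidiagonal_of_summable_norm h1' h2'
  have h4 := tsum_mul_tsum_eq_tsum_sum_antidiagonal_of_summable_norm h1' h2'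
  have h5 := h3.of_norm.hasSum
  rw [← h4, h1.tsum_eq, h2.tsum_eq] at h5
  refine h5.congr_fun fun n => ?_
  rw [PowerSeries.coeff_mul, Finset.sum_mul]
  refine Finset.sum_congr rfl fun ij hij => ?_
  rw [← Finset.HasAntidiagonal.mem_antidiagonal.mp hij, pow_add]
  ring

lemma const (c : ℂ) : PunctHasSum (PowerSeries.C c) (fun _ => c) := by
  refine Eventually.of_forall fun z => ?_
  convert hasSum_single (f := fun n : ℕ => PowerSeries.coeff n (PowerSeries.C c) * z ^ n) 0 ?_
    using 1
  · simp
  · intro n hn; simp [PowerSeries.coeff_C, hn]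

lemma one : PunctHasSum 1 (fun _ => 1) := by
  simpa using const 1

lemma X : PunctHasSum PowerSeries.X (fun z => z) := by
  refine Eventually.of_forall fun z => ?_
  convert hasSum_single (f := fun n : ℕ => PowerSeries.coeff n (PowerSeries.X : PowerSeries ℂ)
    * z ^ n) 1 ?_ using 1
  · simp
  · intro n hn; simp [PowerSeries.coeff_X, hn]

lemma exp_mul (a : ℂ) :
    PunctHasSum (PowerSeries.rescale a (PowerSeries.exp ℂ)) (fun z => Complex.exp (a * z)) := by
  refine Eventually.of_forall fun z => ?_
  have := NormedSpace.expSeries_div_hasSum_exp (a * z)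
  rw [← Complex.exp_eq_exp_ℂ] at this
  refine this.congr_fun fun n => ?_
  rw [PowerSeries.coeff_rescale, PowerSeries.coeff_exp, mul_pow]
  simp
  ring

lemma exp : PunctHasSum (PowerSeries.exp ℂ) (fun z => Complex.exp z) := by
  simpa using exp_mul 1

end PunctHasSum

/-- In a punctured neighbourhood of `0`, `e(κ)e^Z ≠ 1`. -/
lemma eventually_ee_mul_exp_ne_one (κ : ℂ) :
    ∀ᶠ Z in 𝓝[≠] (0 : ℂ), ee κ * Complex.exp Z - 1 ≠ 0 := by
  have hd : HasDerivAt (fun Z : ℂ => ee κ * Complex.exp Z) (ee κ * Complex.exp 0) 0 :=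
    (Complex.hasDerivAt_exp 0).const_mul _
  have := hd.eventually_ne (c := 1) (mul_ne_zero (ee_ne_zero _) (Complex.exp_ne_zero _))
  filter_upwards [this] with Z hZ
  exact sub_ne_zero.mpr hZ

section TaylorCoefficients

variable {C : ℕ → ℂ → ℝ → ℂ}
  (hC : ∀ (X : ℂ) (κ : ℝ), ∀ᶠ Z in nhdsWithin (0 : ℂ) {(0 : ℂ)}ᶜ,
      HasSum (fun j : ℕ => C j X κ * Z ^ j / (Nat.factorial j : ℂ))
        (Z * ee (X * (κ : ℂ)) * Complex.exp (X * Z) / (ee ((κ : ℝ) : ℂ) * Complex.exp Z - 1)))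

/-- The exponential generating series of `C`. -/
def genC (C : ℕ → ℂ → ℝ → ℂ) (X : ℂ) (κ : ℝ) : PowerSeries ℂ :=
  PowerSeries.mk fun j => C j X κ / (Nat.factorial j : ℂ)

include hC

lemma punctHasSum_genC (X : ℂ) (κ : ℝ) : PunctHasSum (genC C X κ) fun Z =>
    Z * ee (X * (κ : ℂ)) * Complex.exp (X * Z) / (ee ((κ : ℝ) : ℂ) * Complex.exp Z - 1) := by
  filter_upwards [hC X κ] with Z hZ
  convert hZ using 2 with j
  rw [genC, PowerSeries.coeff_mk]
  ring

lemma genC_eq (X : ℂ) (κ : ℝ) : genC C X κ =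
    PowerSeries.C (ee (X * κ)) * (PowerSeries.rescale X (PowerSeries.exp ℂ) * genC C 0 κ) := by
  refine (punctHasSum_genC hC X κ).unique ?_
  refine ((PunctHasSum.const _).mul
    ((PunctHasSum.exp_mul X).mul (punctHasSum_genC hC 0 κ))).congr ?_
  refine Eventually.of_forall fun z => ?_
  simp only [Pi.mul_apply, zero_mul, ee_zero, Complex.exp_zero]
  ring

lemma genC_zero_mul (κ : ℝ) :
    genC C 0 κ * (PowerSeries.C (ee (κ : ℂ)) * PowerSeries.exp ℂ - 1) = PowerSeries.X := by
  refine PunctHasSum.unique ((punctHasSum_genC hC 0 κ).mul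
    (((PunctHasSum.const _).mul PunctHasSum.exp).sub PunctHasSum.one)) ?_
  refine PunctHasSum.X.congr ?_
  filter_upwards [eventually_ee_mul_exp_ne_one (κ : ℂ)] with z hz
  simp only [Pi.mul_apply, Pi.sub_apply, zero_mul, ee_zero, Complex.exp_zero]
  field_simp

lemma genC_zero_of_ee_eq_one {κ : ℝ} (h : ee (κ : ℂ) = 1) :
    genC C 0 κ = bernoulliPowerSeries ℂ := by
  have h1 := genC_zero_mul hC κ
  rw [h, map_one, one_mul, ← bernoulliPowerSeries_mul_exp_sub_one ℂ] at h1
  refine mul_right_cancel₀ ?_ h1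
  intro h0
  have := congrArg (PowerSeries.coeff 1) h0
  simp [PowerSeries.coeff_exp, PowerSeries.coeff_one] at this

lemma C_zero_zero (κ : ℝ) : C 0 0 κ = dInt κ := by
  rw [dInt_eq_ite]
  split_ifs with h
  · have := congrArg (PowerSeries.coeff 0) (genC_zero_of_ee_eq_one hC h)
    simpa [genC, bernoulliPowerSeries] using this
  · have := congrArg (PowerSeries.coeff 0) (genC_zero_mul hC κ)
    simp [genC, sub_eq_zero, h] at this
    exact this

lemma C_zero (X : ℂ) (κ : ℝ) : C 0 X κ = ee (X * κ) * dInt κ := by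
  have := congrArg (PowerSeries.coeff 0) (genC_eq hC X κ)
  rw [← C_zero_zero hC]
  simpa [genC, PowerSeries.coeff_mul, PowerSeries.coeff_C_mul] using this

lemma C_one (X : ℂ) (κ : ℝ) :
    C 1 X κ = ee (X * κ) * (if ee (κ : ℂ) = 1 then X - 1 / 2 else 1 / (ee (κ : ℂ) - 1)) := by
  have h1 := congrArg (PowerSeries.coeff 1) (genC_eq hC X κ)
  have h2 : C 1 X κ = ee (X * κ) * (C 1 0 κ + X * C 0 0 κ) := by
    simpa [genC, PowerSeries.coeff_C_mul, PowerSeries.coeff_mul,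
      Finset.Nat.antidiagonal_succ, PowerSeries.coeff_exp] using h1
  rw [h2, C_zero_zero hC, dInt_eq_ite]
  congr 1
  split_ifs with h
  · have := congrArg (PowerSeries.coeff 1) (genC_zero_of_ee_eq_one hC h)
    simp [genC, bernoulliPowerSeries] at this
    rw [this]; ring
  · have := congrArg (PowerSeries.coeff 1) (genC_zero_mul hC κ)
    simp [genC, PowerSeries.coeff_mul, Finset.Nat.antidiagonal_succ, PowerSeries.coeff_exp,
      C_zero_zero hC, dInt_eq_ite, h] at this
    have h3 : ee (κ : ℂ) - 1 ≠ 0 := sub_ne_zero.mpr h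
    rw [mul_zero, add_zero, eq_div_iff h3, this]

end TaylorCoefficients

/-- The elliptic building block `e(Pw)/(1 - e(w))`. -/
def geoTerm (P : ℝ) (w : ℂ) : ℂ := ee (P * w) / (1 - ee w)

/-- The half series `∑_{m ≥ 1} c^m e(P(a+σm))/(1 - e(a+σm))`. -/
def geoSeries (c : ℂ) (P : ℝ) (σ a : ℂ) : ℂ :=
  ∑' m : ℕ, c ^ (m + 1) * geoTerm P (a + σ * (m + 1))

/-- The bilateral series built from two half series. -/
def geoBilateral (c : ℂ) (P P' : ℝ) (σ a : ℂ) : ℂ :=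
  geoTerm P a + geoSeries c P σ a - geoSeries c⁻¹ P' σ (-a)

lemma one_sub_ee_ne_zero_of_im_pos {w : ℂ} (hw : 0 < w.im) : 1 - ee w ≠ 0 := by
  intro h
  have h1 : ee w = 1 := (sub_eq_zero.mp h).symm
  rw [ee_eq_one_iff] at h1
  obtain ⟨n, rfl⟩ := h1
  simp at hw

lemma norm_geoTerm_le {P : ℝ} (hP : 0 ≤ P) {w : ℂ} {y : ℝ} (hy : 0 < y) (hw : y ≤ w.im) :
    ‖geoTerm P w‖ ≤ Real.exp (-2 * π * P * y) / (1 - Real.exp (-2 * π * y)) := by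
  have hpi := Real.pi_pos
  rw [geoTerm, norm_div]
  have h1 : Real.exp (-2 * π * y) < 1 := by
    rw [Real.exp_lt_one_iff]; nlinarith [mul_pos hpi hy]
  refine div_le_div₀ (Real.exp_nonneg _) ?_ (by linarith) ?_
  · rw [norm_ee, Real.exp_le_exp]
    simp only [Complex.im_ofReal_mul]
    nlinarith [mul_nonneg hpi.le hP]
  · have h2 : ‖ee w‖ ≤ Real.exp (-2 * π * y) := by
      rw [norm_ee, Real.exp_le_exp]; nlinarith
    have h3 := norm_sub_norm_le (1 : ℂ) (ee w)
    rw [norm_one] at h3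
    linarith

/-- A uniform summable majorant of the terms of `geoSeries`. -/
lemma geoSeries_majorant {c : ℂ} (hc : ‖c‖ = 1) {P : ℝ} (hP : 0 < P) {σ : ℂ} (hσ : 0 < σ.im)
    {ρ : ℝ} (hρ : ρ < 1) (hρ0 : 0 ≤ ρ) : ∃ u : ℕ → ℝ, Summable u ∧
    ∀ (m : ℕ) (a : ℂ), -(ρ * σ.im) ≤ a.im → ‖c ^ (m + 1) * geoTerm P (a + σ * (m + 1))‖ ≤ u m := by
  set d : ℝ := (1 - ρ) * σ.im with hd
  have hd0 : 0 < d := mul_pos (by linarith) hσ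
  have hpi := Real.pi_pos
  have hq : Real.exp (-2 * π * d) < 1 := by
    rw [Real.exp_lt_one_iff]; nlinarith [mul_pos hpi hd0]
  have hq' : Real.exp (-2 * π * P * d) < 1 := by
    rw [Real.exp_lt_one_iff]; nlinarith [mul_pos (mul_pos hpi hd0) hP]
  refine ⟨fun m => Real.exp (-2 * π * P * d) ^ (m + 1) / (1 - Real.exp (-2 * π * d)), ?_, ?_⟩
  · exact ((summable_nat_add_iff 1).mpr
      (summable_geometric_of_lt_one (Real.exp_nonneg _) hq')).div_const _
  · intro m a ha
    rw [norm_mul, norm_pow, hc, one_pow, one_mul]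
    have hm : (0 : ℝ) ≤ m := Nat.cast_nonneg m
    have him : d * (m + 1) ≤ (a + σ * (m + 1)).im := by
      have : (a + σ * (m + 1)).im = a.im + σ.im * (m + 1) := by
        simp [Complex.add_im, Complex.mul_im]
      rw [this, hd]
      nlinarith [mul_nonneg (mul_nonneg hρ0 hσ.le) hm]
    refine (norm_geoTerm_le hP.le (by positivity) him).trans ?_
    simp only [← Real.exp_nat_mul]
    have h5 : Real.exp (-2 * π * (d * (m + 1))) ≤ Real.exp (-2 * π * d) := by
      rw [Real.exp_le_exp]; nlinarith [mul_nonneg (mul_pos hpi hd0).le hm]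
    refine div_le_div₀ (Real.exp_nonneg _) (le_of_eq ?_) (by linarith) (by linarith)
    push_cast; ring_nf

section geo

variable {c : ℂ} {P P' : ℝ} {σ : ℂ}

lemma summable_geoSeries (hc : ‖c‖ = 1) (hP : 0 < P) (hσ : 0 < σ.im) {a : ℂ}
    (ha : -σ.im < a.im) :
    Summable fun m : ℕ => c ^ (m + 1) * geoTerm P (a + σ * (m + 1)) := by
  obtain ⟨u, hu, hb⟩ := geoSeries_majorant hc hP hσ (ρ := max 0 (-a.im / σ.im))
    (max_lt one_pos (by rw [div_lt_one hσ]; linarith)) (le_max_left _ _)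
  refine Summable.of_norm_bounded hu fun m => hb m a ?_
  have : -a.im / σ.im * σ.im ≤ max 0 (-a.im / σ.im) * σ.im := by
    gcongr; exact le_max_right _ _
  rw [div_mul_cancel₀ _ hσ.ne'] at this
  linarith

lemma differentiableAt_geoTerm {w : ℂ} (hw : 1 - ee w ≠ 0) :
    DifferentiableAt ℂ (geoTerm P) w := by
  unfold geoTerm ee at *
  fun_prop (disch := assumption)

lemma differentiableOn_geoSeries (hc : ‖c‖ = 1) (hP : 0 < P) (hσ : 0 < σ.im) {ρ : ℝ}
    (hρ : ρ < 1) (hρ0 : 0 ≤ ρ) :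
    DifferentiableOn ℂ (geoSeries c P σ) {a | -(ρ * σ.im) < a.im} := by
  obtain ⟨u, hu, hb⟩ := geoSeries_majorant hc hP hσ hρ hρ0
  refine Complex.differentiableOn_tsum_of_summable_norm hu (fun m => ?_)
    (isOpen_lt continuous_const Complex.continuous_im) (fun m a ha => hb m a (le_of_lt ha))
  intro a ha
  have him : 0 < (a + σ * (m + 1)).im := by
    have h : (a + σ * (m + 1)).im = a.im + σ.im * (m + 1) := by
      simp [Complex.add_im, Complex.mul_im]
    have ha' : -(ρ * σ.im) < a.im := ha
    have hm : (0 : ℝ) ≤ m := Nat.cast_nonneg m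
    rw [h]; nlinarith [mul_nonneg hσ.le hm]
  have h1 := differentiableAt_geoTerm (P := P) (one_sub_ee_ne_zero_of_im_pos him)
  have h2 : DifferentiableAt ℂ (fun a : ℂ => a + σ * (m + 1)) a := by fun_prop
  exact ((h1.comp a h2).const_mul _).differentiableWithinAt

lemma geoSeries_shift (hc : ‖c‖ = 1) (hP : 0 < P) (hσ : 0 < σ.im) {a : ℂ}
    (ha : -σ.im < a.im) :
    geoSeries c P σ a = c * geoTerm P (a + σ) + c * geoSeries c P σ (a + σ) := by
  rw [geoSeries, (summable_geoSeries hc hP hσ ha).tsum_eq_zero_add, geoSeries, ← tsum_mul_left]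
  congr 1
  · simp
  · refine tsum_congr fun m => ?_
    push_cast
    rw [show a + σ * ((m : ℂ) + 1 + 1) = a + σ + σ * (m + 1) by ring]
    ring

lemma geoTerm_add_one (w : ℂ) : geoTerm P (w + 1) = ee P * geoTerm P w := by
  have h1 : ee (w + 1) = ee w := by simpa using ee_add_intCast w 1
  rw [geoTerm, h1, mul_add, ee_add, mul_one, geoTerm]
  ring

lemma geoTerm_sub_one (w : ℂ) : geoTerm P (w - 1) = ee (-P) * geoTerm P w := by
  have := geoTerm_add_one (P := P) (w - 1)
  rw [sub_add_cancel] at this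
  rw [this, ee_neg, inv_mul_cancel_left₀ (ee_ne_zero _)]

lemma geoSeries_add_one (a : ℂ) : geoSeries c P σ (a + 1) = ee P * geoSeries c P σ a := by
  rw [geoSeries, geoSeries, ← tsum_mul_left]
  refine tsum_congr fun m => ?_
  rw [add_right_comm, geoTerm_add_one]; ring

lemma geoSeries_sub_one (a : ℂ) : geoSeries c P σ (a - 1) = ee (-P) * geoSeries c P σ a := by
  rw [geoSeries, geoSeries, ← tsum_mul_left]
  refine tsum_congr fun m => ?_
  rw [show a - 1 + σ * (m + 1) = a + σ * (m + 1) - 1 by ring, geoTerm_sub_one]; ring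

lemma geoBilateral_add_one (h : ee P = ee (-P')) (a : ℂ) :
    geoBilateral c P P' σ (a + 1) = ee P * geoBilateral c P P' σ a := by
  rw [geoBilateral, geoBilateral, geoTerm_add_one, geoSeries_add_one, neg_add',
    geoSeries_sub_one, ← h]
  ring

lemma geoBilateral_sub_one (h : ee P = ee (-P')) (a : ℂ) :
    geoBilateral c P P' σ (a - 1) = ee (-P) * geoBilateral c P P' σ a := by
  have := geoBilateral_add_one (c := c) (σ := σ) h (a - 1)
  rw [sub_add_cancel] at this
  rw [this, ee_neg, inv_mul_cancel_left₀ (ee_ne_zero _)]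

lemma geoBilateral_add_period (hc : ‖c‖ = 1) (hP : 0 < P) (hP' : 0 < P') (hσ : 0 < σ.im) {a : ℂ}
    (ha : -σ.im < a.im) (ha' : a.im < 0) :
    geoBilateral c P P' σ (a + σ) =
      c⁻¹ * (geoBilateral c P P' σ a - (geoTerm P a + geoTerm P' (-a))) := by
  have hc0 : c ≠ 0 := by rintro rfl; simp at hc
  have hci : ‖c⁻¹‖ = 1 := by rw [norm_inv, hc, inv_one]
  have h1 := geoSeries_shift hc hP hσ ha
  have h2 := geoSeries_shift (a := -(a + σ)) hci hP' hσ (by simp; linarith)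
  rw [show -(a + σ) + σ = -a by ring] at h2
  rw [geoBilateral, geoBilateral, h1, h2]
  field_simp
  ring

lemma geoTerm_add_geoTerm_neg_of_add_eq_one (h : P + P' = 1) (w : ℂ) :
    geoTerm P w + geoTerm P' (-w) = 0 := by
  obtain rfl : P' = 1 - P := by linarith
  have h1 : ee (((1 - P : ℝ) : ℂ) * -w) = ee (P * w) * (ee w)⁻¹ := by
    rw [← ee_neg, ← ee_add]; congr 1; push_cast; ring
  rw [geoTerm, geoTerm, h1, ee_neg]
  have h0 := ee_ne_zero w
  by_cases h : 1 - ee w = 0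
  · have : ee w = 1 := (sub_eq_zero.mp h).symm
    simp [this]
  · have h' : ee w - 1 ≠ 0 := fun h2 => h (by rw [← neg_sub, h2, neg_zero])
    rw [show 1 - (ee w)⁻¹ = (ee w - 1) / ee w by field_simp]
    field_simp
    ring

lemma geoTerm_one_add_neg {w : ℂ} (hw : 1 - ee w ≠ 0) :
    geoTerm 1 w + geoTerm 1 (-w) = -1 := by
  have h0 := ee_ne_zero w
  have h' : ee w - 1 ≠ 0 := fun h2 => hw (by rw [← neg_sub, h2, neg_zero])
  simp only [geoTerm, Complex.ofReal_one, one_mul, ee_neg]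
  rw [show 1 - (ee w)⁻¹ = (ee w - 1) / ee w by field_simp]
  field_simp
  ring

lemma geoBilateral_neg (P : ℝ) (a : ℂ) (hc : c⁻¹ = c) :
    geoBilateral c P P σ (-a) = geoTerm P a + geoTerm P (-a) - geoBilateral c P P σ a := by
  rw [geoBilateral, geoBilateral, hc, neg_neg]; ring

end geo

lemma ee_fracP (x : ℝ) : ee (fracP x : ℂ) = ee (x : ℂ) := by
  rw [fracP_eq_add_intCast, Complex.ofReal_add, Complex.ofReal_intCast, ee_add_intCast]

lemma fracP_eq_one_of_ee_eq_one {μ : ℝ} (h : ee (μ : ℂ) = 1) : fracP μ = 1 := by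
  obtain ⟨n, hn⟩ := (ee_eq_one_iff _).mp h
  have hn' : μ = n := by exact_mod_cast hn
  rw [fracP, hn', ← Int.cast_neg, Int.fract_intCast, sub_zero]

lemma fracP_neg_add_fracP_of_ee_ne_one {μ : ℝ} (h : ee (μ : ℂ) ≠ 1) :
    fracP (-μ) + fracP μ = 1 := by
  have h1 : Int.fract μ ≠ 0 := by
    intro h0
    apply h
    rw [ee_eq_one_iff]
    rw [Int.fract_eq_iff] at h0
    obtain ⟨-, -, z, hz⟩ := h0
    exact ⟨z, by rw [← Complex.ofReal_intCast, ← hz, sub_zero]⟩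
  rw [fracP, fracP, neg_neg, Int.fract_neg h1]
  ring

/-- The difference of the two sides of the Kronecker type identity for the generating functions
of `𝒮_{-K}`, `K ≥ 0`. -/
def kronDiff (τ : ℂ) (μ : ℝ) (a : ℂ) : ℂ :=
  geoBilateral 1 (fracP (-μ)) (fracP μ) (I * τ) a + dInt μ / 2 +
    I / τ * (if ee (μ : ℂ) = 1 then a - 1 / 2 else 1 / (ee (μ : ℂ) - 1)) -
    I / τ * geoBilateral (ee (μ : ℂ)) 1 1 (I / τ) (I / τ * a)

section kron

variable {τ : ℂ} {μ : ℝ}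

lemma ee_neg_eq_one_iff (a : ℂ) : ee (-a) = 1 ↔ ee a = 1 := by
  rw [ee_neg, inv_eq_one]

lemma im_I_div_pos (hτ : 0 < τ.re) : 0 < (I / τ).im := by
  have h0 : τ ≠ 0 := by rintro rfl; simp at hτ
  rw [Complex.div_im]
  have := Complex.normSq_pos.mpr h0
  simp
  positivity

lemma one_sub_ee_ne_zero_of_im_ne_zero {w : ℂ} (hw : w.im ≠ 0) : 1 - ee w ≠ 0 := by
  intro h
  obtain ⟨n, rfl⟩ := (ee_eq_one_iff _).mp (sub_eq_zero.mp h).symm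
  simp at hw

lemma kronDiff_add_period (hτ : 0 < τ.re) {a : ℂ} (ha : -τ.re < a.im) (ha' : a.im < 0) :
    kronDiff τ μ (a + I * τ) = kronDiff τ μ a := by
  have h0 : τ ≠ 0 := by rintro rfl; simp at hτ
  have h1 := geoBilateral_add_period (c := 1) (P := fracP (-μ)) (P' := fracP μ) (σ := I * τ)
    (a := a) norm_one (fracP_pos _) (fracP_pos _) (by simpa using hτ) (by simpa using ha) ha'
  have h2 : I / τ * (a + I * τ) = I / τ * a - 1 := by
    field_simp; linear_combination τ * I_sq
  have h3 := geoBilateral_sub_one (c := ee (μ : ℂ)) (P := 1) (P' := 1) (σ := I / τ)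
    (by rw [ee_neg, Complex.ofReal_one, show ee 1 = 1 by simpa using ee_intCast 1, inv_one])
    (I / τ * a)
  rw [Complex.ofReal_one, ee_neg, show ee 1 = 1 by simpa using ee_intCast 1, inv_one, one_mul] at h3
  rw [kronDiff, kronDiff, h1, h2, h3, dInt_eq_ite]
  split_ifs with h
  · have h' : ee ((-μ : ℝ) : ℂ) = 1 := by rw [Complex.ofReal_neg, ee_neg_eq_one_iff, h]
    rw [fracP_eq_one_of_ee_eq_one h, fracP_eq_one_of_ee_eq_one h',
      geoTerm_one_add_neg (one_sub_ee_ne_zero_of_im_ne_zero ha'.ne)]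
    field_simp
    linear_combination 2 * τ * I_sq
  · rw [geoTerm_add_geoTerm_neg_of_add_eq_one (fracP_neg_add_fracP_of_ee_ne_one h)]
    simp

lemma kronDiff_add_one (hτ : 0 < τ.re) {a : ℂ} (ha : -(I / τ).im < (I / τ * a).im)
    (ha' : (I / τ * a).im < 0) :
    kronDiff τ μ (a + 1) = ee (-μ) * kronDiff τ μ a := by
  have h0 : τ ≠ 0 := by rintro rfl; simp at hτ
  have hp : ee ((fracP (-μ) : ℝ) : ℂ) = ee (-μ) := by
    rw [ee_fracP, Complex.ofReal_neg]
  have h1 := geoBilateral_add_one (c := 1) (P := fracP (-μ)) (P' := fracP μ) (σ := I * τ)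
    (by rw [hp, ee_neg, ee_neg, ee_fracP]) a
  have h3 := geoBilateral_add_period (c := ee (μ : ℂ)) (P := 1) (P' := 1) (σ := I / τ)
    (a := I / τ * a) (norm_ee_ofReal _) one_pos one_pos (im_I_div_pos hτ) ha ha'
  rw [geoTerm_one_add_neg (one_sub_ee_ne_zero_of_im_ne_zero ha'.ne)] at h3
  rw [kronDiff, kronDiff, h1, mul_add, mul_one, h3, dInt_eq_ite, hp, ee_neg]
  split_ifs with h
  · rw [h]; ring
  · have h4 := ee_ne_zero (μ : ℂ)
    have h5 : ee (μ : ℂ) - 1 ≠ 0 := sub_ne_zero.mpr h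
    field_simp
    ring

lemma kronDiff_neg (h : ee (μ : ℂ) = 1) {a : ℂ} (ha : 1 - ee a ≠ 0)
    (ha' : 1 - ee (I / τ * a) ≠ 0) : kronDiff τ μ (-a) = -kronDiff τ μ a := by
  have h' : ee ((-μ : ℝ) : ℂ) = 1 := by rw [Complex.ofReal_neg, ee_neg_eq_one_iff, h]
  rw [kronDiff, kronDiff, fracP_eq_one_of_ee_eq_one h, fracP_eq_one_of_ee_eq_one h', mul_neg,
    geoBilateral_neg _ _ inv_one, geoTerm_one_add_neg ha, h, geoBilateral_neg _ _ inv_one,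
    geoTerm_one_add_neg ha', dInt_eq_ite, h, if_pos rfl, if_pos rfl, if_pos rfl]
  ring

lemma tendsto_mul_geoTerm (P : ℝ) :
    Tendsto (fun a : ℂ => a * geoTerm P a) (𝓝[≠] 0) (𝓝 (-(2 * π * I)⁻¹)) := by
  have hd : HasDerivAt ee (2 * π * I) 0 := by
    have h : HasDerivAt (fun s : ℂ => 2 * (π : ℂ) * I * s) (2 * π * I) 0 := by
      simpa using (hasDerivAt_id (0 : ℂ)).const_mul (2 * (π : ℂ) * I)
    simpa [ee] using! h.cexp
  have h1 := hasDerivAt_iff_tendsto_slope.mp hd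
  have h2 := h1.inv₀ Complex.two_pi_I_ne_zero
  have h3 : Tendsto (fun a : ℂ => ee (P * a)) (𝓝[≠] 0) (𝓝 1) := by
    have : Continuous fun a : ℂ => ee (P * a) := by unfold ee; fun_prop
    have := this.tendsto 0
    simp only [mul_zero, ee_zero] at this
    exact this.mono_left nhdsWithin_le_nhds
  have h4 := (h2.mul h3).neg
  rw [mul_one] at h4
  refine h4.congr fun a => ?_
  rw [slope_def_field, ee_zero, sub_zero, geoTerm, inv_div, ← neg_sub (ee a) 1, div_neg]
  ring

/-- The open period parallelogram, scaled by `2ρ` and centred at the origin. -/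
def kronRegion (τ : ℂ) (ρ : ℝ) : Set ℂ :=
  {a | |a.im| < ρ * τ.re} ∩ {a | |(I / τ * a).im| < ρ * (I / τ).im}

lemma isOpen_kronRegion (τ : ℂ) (ρ : ℝ) : IsOpen (kronRegion τ ρ) := by
  refine IsOpen.inter ?_ ?_
  · exact isOpen_lt (by fun_prop) continuous_const
  · exact isOpen_lt (by fun_prop) continuous_const

lemma convex_kronRegion (τ : ℂ) (ρ : ℝ) : Convex ℝ (kronRegion τ ρ) := by
  refine Convex.inter ?_ ?_
  · have : {a : ℂ | |a.im| < ρ * τ.re} = Complex.imLm ⁻¹' Metric.ball 0 (ρ * τ.re) := by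
      ext a; simp [Complex.imLm]
    rw [this]
    exact (convex_ball _ _).linear_preimage _
  · have : {a : ℂ | |(I / τ * a).im| < ρ * (I / τ).im} =
        (Complex.imLm ∘ₗ (LinearMap.mulLeft ℝ (I / τ))) ⁻¹' Metric.ball 0 (ρ * (I / τ).im) := by
      ext a
      rw [Set.mem_preimage, mem_ball_zero_iff, Real.norm_eq_abs]
      rfl
    rw [this]
    exact (convex_ball _ _).linear_preimage _

lemma one_sub_ee_ne_zero_of_mem (hτ : 0 < τ.re) {a : ℂ} (ha0 : a ≠ 0)
    (ha1 : |a.im| < τ.re) (ha2 : |(I / τ * a).im| < (I / τ).im) :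
    1 - ee a ≠ 0 ∧ 1 - ee (I / τ * a) ≠ 0 := by
  have h0 : τ ≠ 0 := by rintro rfl; simp at hτ
  have hp := im_I_div_pos hτ
  constructor
  · intro h
    obtain ⟨n, rfl⟩ := (ee_eq_one_iff _).mp (sub_eq_zero.mp h).symm
    rw [← Complex.ofReal_intCast, mul_comm, Complex.im_ofReal_mul, abs_mul, abs_of_pos hp] at ha2
    have h1 : |((n : ℤ) : ℝ)| < 1 := by nlinarith
    have h2 : |n| < 1 := by exact_mod_cast h1
    rw [Int.abs_lt_one_iff] at h2
    simp [h2] at ha0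
  · intro h
    obtain ⟨n, hn⟩ := (ee_eq_one_iff _).mp (sub_eq_zero.mp h).symm
    have ha : a = ((-n : ℝ) : ℂ) * (I * τ) := by
      push_cast
      rw [← hn]; field_simp; linear_combination I_sq
    rw [ha, Complex.im_ofReal_mul, abs_mul, Complex.I_mul_im, abs_of_pos hτ, abs_neg] at ha1
    have h1 : |((n : ℤ) : ℝ)| < 1 := by nlinarith
    have h2 : |n| < 1 := by exact_mod_cast h1
    rw [Int.abs_lt_one_iff] at h2
    simp [h2] at ha
    exact ha0 ha
end kron

section kron

variable {τ : ℂ} {μ : ℝ}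

lemma differentiableAt_kronDiff (hτ : 0 < τ.re) {a : ℂ} (ha0 : a ≠ 0) {ρ : ℝ} (hρ : ρ < 1)
    (hρ0 : 0 ≤ ρ) (ha : a ∈ kronRegion τ ρ) : DifferentiableAt ℂ (kronDiff τ μ) a := by
  have hp := im_I_div_pos hτ
  obtain ⟨h1, h2⟩ := ha
  simp only [Set.mem_ofPred_eq] at h1 h2
  have h3 := one_sub_ee_ne_zero_of_mem hτ ha0 (by nlinarith) (by nlinarith)
  have hs : ∀ {c : ℂ} (_ : ‖c‖ = 1) {P : ℝ} (_ : 0 < P) {σ : ℂ} (_ : 0 < σ.im) {w : ℂ}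
      (_ : |w.im| < ρ * σ.im), DifferentiableAt ℂ (geoSeries c P σ) w := by
    intro c hc P hP σ hσ w hw
    refine (differentiableOn_geoSeries hc hP hσ hρ hρ0).differentiableAt ?_
    refine IsOpen.mem_nhds (isOpen_lt continuous_const Complex.continuous_im) ?_
    exact (abs_lt.mp hw).1
  have hb : ∀ {c : ℂ} (_ : ‖c‖ = 1) {P P' : ℝ} (_ : 0 < P) (_ : 0 < P') {σ : ℂ} (_ : 0 < σ.im)
      {w : ℂ} (_ : |w.im| < ρ * σ.im) (_ : 1 - ee w ≠ 0),
      DifferentiableAt ℂ (geoBilateral c P P' σ) w := by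
    intro c hc P P' hP hP' σ hσ w hw hw'
    unfold geoBilateral
    refine ((differentiableAt_geoTerm hw').add (hs hc hP hσ hw)).sub ?_
    exact (hs (by rw [norm_inv, hc, inv_one]) hP' hσ (w := -w) (by simpa using hw)).comp w
      differentiableAt_id.neg
  unfold kronDiff
  refine (((hb norm_one (fracP_pos _) (fracP_pos _) (by simpa using hτ) (by simpa using h1)
    h3.1).add_const _).add (?_)).sub ?_
  · refine DifferentiableAt.const_mul ?_ _
    split_ifs <;> fun_prop
  · refine DifferentiableAt.const_mul ?_ _
    exact (hb (norm_ee_ofReal _) one_pos one_pos hp h2 h3.2).comp a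
      (differentiableAt_id.const_mul _)

lemma tendsto_mul_kronDiff (hτ : 0 < τ.re) :
    Tendsto (fun a => a * kronDiff τ μ a) (𝓝[≠] 0) (𝓝 0) := by
  have h0 : τ ≠ 0 := by rintro rfl; simp at hτ
  have hp := im_I_div_pos hτ
  have hid : Tendsto (fun a : ℂ => a) (𝓝[≠] 0) (𝓝 0) := tendsto_id.mono_left nhdsWithin_le_nhds
  have hs : ∀ {c : ℂ} (_ : ‖c‖ = 1) {P : ℝ} (_ : 0 < P) {σ : ℂ} (_ : 0 < σ.im) (s : ℂ),
      Tendsto (fun a : ℂ => a * geoSeries c P σ (s * a)) (𝓝[≠] 0) (𝓝 0) := by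
    intro c hc P hP σ hσ s
    have : ContinuousAt (fun a => geoSeries c P σ (s * a)) 0 := by
      refine ContinuousAt.comp (f := fun a => s * a) (g := geoSeries c P σ) ?_ (by fun_prop)
      refine ((differentiableOn_geoSeries hc hP hσ (ρ := 1 / 2) (by norm_num)
        (by norm_num)).differentiableAt ?_).continuousAt
      refine IsOpen.mem_nhds (isOpen_lt continuous_const Complex.continuous_im) ?_
      simp [hσ]
    simpa using hid.mul (this.tendsto.mono_left nhdsWithin_le_nhds)
  have hg : Tendsto (fun a : ℂ => a * (I / τ * geoTerm 1 (I / τ * a))) (𝓝[≠] 0)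
      (𝓝 (-(2 * π * I)⁻¹)) := by
    have hne : I / τ ≠ 0 := div_ne_zero I_ne_zero h0
    have : Tendsto (fun a : ℂ => I / τ * a) (𝓝[≠] 0) (𝓝[≠] 0) := by
      rw [tendsto_nhdsWithin_iff]
      refine ⟨by simpa using hid.const_mul (I / τ), ?_⟩
      filter_upwards [self_mem_nhdsWithin] with a ha
      exact mul_ne_zero hne ha
    refine ((tendsto_mul_geoTerm 1).comp this).congr fun a => ?_
    simp only [Function.comp]; ring
  have hc : Tendsto (fun a : ℂ => a * (dInt μ / 2 +
      I / τ * (if ee (μ : ℂ) = 1 then a - 1 / 2 else 1 / (ee (μ : ℂ) - 1)))) (𝓝[≠] 0) (𝓝 0) := by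
    have : Continuous fun a : ℂ => a * (dInt μ / 2 +
      I / τ * (if ee (μ : ℂ) = 1 then a - 1 / 2 else 1 / (ee (μ : ℂ) - 1))) := by
      split_ifs <;> fun_prop
    have := this.tendsto 0
    rw [zero_mul] at this
    exact this.mono_left nhdsWithin_le_nhds
  have hστ : 0 < (I * τ).im := by simpa using hτ
  have k1 := hs norm_one (fracP_pos (-μ)) hστ 1
  have k2 := hs (c := 1⁻¹) (by simp) (fracP_pos μ) hστ (-1)
  have k3 := hs (norm_ee_ofReal μ) one_pos hp (I / τ)
  have k4 := hs (c := (ee μ)⁻¹) (by rw [norm_inv, norm_ee_ofReal, inv_one]) one_pos hp (-(I / τ))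
  have := (((tendsto_mul_geoTerm (fracP (-μ))).add (k1.sub k2)).add hc).sub
    (hg.add ((k3.sub k4).const_mul (I / τ)))
  simp only [mul_zero, add_zero, sub_self] at this
  refine this.congr fun a => ?_
  rw [kronDiff, geoBilateral, geoBilateral]
  simp only [one_mul, neg_mul]
  ring

lemma exists_coords (hτ : 0 < τ.re) (a : ℂ) : ∃ x y : ℝ, a = x + y * (I * τ) := by
  refine ⟨a.re - a.im / τ.re * (I * τ).re, a.im / τ.re, ?_⟩
  apply Complex.ext
  · simp
  · simp [hτ.ne']

lemma im_coords (x y : ℝ) : ((x : ℂ) + y * (I * τ)).im = y * τ.re := by simp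

lemma im_mul_coords (hτ : 0 < τ.re) (x y : ℝ) :
    (I / τ * (x + y * (I * τ))).im = x * (I / τ).im := by
  have h0 : τ ≠ 0 := by rintro rfl; simp at hτ
  have : I / τ * (x + y * (I * τ)) = x * (I / τ) - y := by
    field_simp; linear_combination y * τ * I_sq
  rw [this]; simp

/-- Every point of the open double period parallelogram is equivalent to one of the closed
fundamental parallelogram. -/
lemma exists_norm_kronDiff_eq (hτ : 0 < τ.re) {x y : ℝ} (hx : |x| < 1) (hy : |y| < 1)
    (h0 : (x : ℂ) + y * (I * τ) ≠ 0) : ∃ x' y' : ℝ, |x'| ≤ 1 / 2 ∧ |y'| ≤ 1 / 2 ∧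
      (x' : ℂ) + y' * (I * τ) ≠ 0 ∧
      ‖kronDiff τ μ (x + y * (I * τ))‖ = ‖kronDiff τ μ (x' + y' * (I * τ))‖ := by
  have hp := im_I_div_pos hτ
  rw [abs_lt] at hx hy
  have step1 : ∃ y' : ℝ, |y'| ≤ 1 / 2 ∧ (x : ℂ) + y' * (I * τ) ≠ 0 ∧
      ‖kronDiff τ μ (x + y * (I * τ))‖ = ‖kronDiff τ μ (x + y' * (I * τ))‖ := by
    have hper : ∀ y : ℝ, -1 < y → y < 0 → kronDiff τ μ (x + (y + 1 : ℝ) * (I * τ)) =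
        kronDiff τ μ (x + y * (I * τ)) := by
      intro y h1 h2
      rw [← kronDiff_add_period hτ (a := x + y * (I * τ))]
      · congr 1; push_cast; ring
      · rw [im_coords]; nlinarith
      · rw [im_coords]; nlinarith
    have hne : ∀ y : ℝ, y ≠ 0 → (x : ℂ) + y * (I * τ) ≠ 0 := by
      intro y hy h
      have := congrArg Complex.im h
      rw [im_coords, Complex.zero_im] at this
      exact hy (by simpa [hτ.ne'] using this)
    rcases lt_or_ge (1 / 2) y with h | h
    · refine ⟨y - 1, by rw [abs_le]; constructor <;> linarith, hne _ (by linarith), ?_⟩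
      rw [← hper (y - 1) (by linarith) (by linarith), sub_add_cancel]
    rcases lt_or_ge y (-(1 / 2)) with h' | h'
    · refine ⟨y + 1, by rw [abs_le]; constructor <;> linarith, hne _ (by linarith), ?_⟩
      rw [hper y (by linarith) (by linarith)]
    · exact ⟨y, abs_le.mpr ⟨h', h⟩, h0, rfl⟩
  obtain ⟨y', hy', hne', he⟩ := step1
  have hper : ∀ x : ℝ, -1 < x → x < 0 → ‖kronDiff τ μ ((x + 1 : ℝ) + y' * (I * τ))‖ =
      ‖kronDiff τ μ (x + y' * (I * τ))‖ := by
    intro x h1 h2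
    have := kronDiff_add_one hτ (μ := μ) (a := x + y' * (I * τ))
      (by rw [im_mul_coords hτ]; nlinarith) (by rw [im_mul_coords hτ]; nlinarith)
    rw [show ((x + 1 : ℝ) : ℂ) + y' * (I * τ) = x + y' * (I * τ) + 1 by push_cast; ring, this,
      norm_mul, ← Complex.ofReal_neg, norm_ee_ofReal, one_mul]
  have hne : ∀ x : ℝ, x ≠ 0 → (x : ℂ) + y' * (I * τ) ≠ 0 := by
    intro x hx h
    have := congrArg (fun z => (I / τ * z).im) h
    simp only [im_mul_coords hτ, mul_zero, Complex.zero_im] at this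
    exact hx (by simpa [hp.ne'] using this)
  rcases lt_or_ge (1 / 2) x with h | h
  · refine ⟨x - 1, y', by rw [abs_le]; constructor <;> linarith, hy', hne _ (by linarith), ?_⟩
    rw [he, ← hper (x - 1) (by linarith) (by linarith), sub_add_cancel]
  rcases lt_or_ge x (-(1 / 2)) with h' | h'
  · refine ⟨x + 1, y', by rw [abs_le]; constructor <;> linarith, hy', hne _ (by linarith), ?_⟩
    rw [he, hper x (by linarith) (by linarith)]
  · exact ⟨x, y', abs_le.mpr ⟨h', h⟩, hy', hne', he⟩

theorem kronDiff_eq_zero (hτ : 0 < τ.re) {a : ℂ} (ha0 : a ≠ 0) {ρ : ℝ} (hρ1 : 1 / 2 < ρ)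
    (hρ : ρ < 1) (ha : a ∈ kronRegion τ ρ) : kronDiff τ μ a = 0 := by
  have h0 : τ ≠ 0 := by rintro rfl; simp at hτ
  have hp := im_I_div_pos hτ
  have mem_region : ∀ x y : ℝ, (x : ℂ) + y * (I * τ) ∈ kronRegion τ ρ ↔ |x| < ρ ∧ |y| < ρ := by
    intro x y
    rw [kronRegion, Set.mem_inter_iff, Set.mem_ofPred_eq, Set.mem_ofPred_eq, im_coords,
      im_mul_coords hτ, abs_mul, abs_mul, abs_of_pos hτ, abs_of_pos hp,
      mul_lt_mul_iff_left₀ hτ, mul_lt_mul_iff_left₀ hp, and_comm]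
  set F : ℂ → ℂ := Function.update (kronDiff τ μ) 0 (limUnder (𝓝[≠] 0) (kronDiff τ μ)) with hF
  have hFne : ∀ z, z ≠ 0 → F z = kronDiff τ μ z := fun z hz => Function.update_of_ne hz _ _
  have hz0 : (0 : ℂ) ∈ kronRegion τ ρ := by
    have := (mem_region 0 0).mpr (by rw [abs_zero]; constructor <;> linarith)
    simpa using this
  have hFd : DifferentiableOn ℂ F (kronRegion τ ρ) := by
    refine Complex.differentiableOn_update_limUnder_of_isLittleO
      ((isOpen_kronRegion τ ρ).mem_nhds hz0) ?_ ?_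
    · intro z hz
      exact (differentiableAt_kronDiff hτ hz.2 hρ (by linarith) hz.1).differentiableWithinAt
    · rw [Asymptotics.isLittleO_iff_tendsto']
      · have h1 := (tendsto_mul_kronDiff (μ := μ) hτ).sub
          ((tendsto_id.mono_left nhdsWithin_le_nhds : Tendsto (fun a : ℂ => a) (𝓝[≠] 0)
            (𝓝 0)).mul_const (kronDiff τ μ 0))
        simp only [zero_mul, sub_zero] at h1
        refine h1.congr fun z => ?_
        rw [sub_zero, div_inv_eq_mul, id]; ring
      · filter_upwards [self_mem_nhdsWithin] with z hz h
        simp only [sub_zero, inv_eq_zero] at h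
        exact absurd h hz
  set K : Set ℂ := (fun p : ℝ × ℝ => (p.1 : ℂ) + p.2 * (I * τ)) ''
    (Set.Icc (-(1 / 2)) (1 / 2) ×ˢ Set.Icc (-(1 / 2)) (1 / 2)) with hK
  have hKc : IsCompact K := (isCompact_Icc.prod isCompact_Icc).image (by fun_prop)
  have memK : ∀ x y : ℝ, |x| ≤ 1 / 2 → |y| ≤ 1 / 2 → (x : ℂ) + y * (I * τ) ∈ K :=
    fun x y hx hy => ⟨(x, y), ⟨abs_le.mp hx, abs_le.mp hy⟩, rfl⟩
  have hKsub : K ⊆ kronRegion τ ρ := by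
    rintro _ ⟨⟨x, y⟩, ⟨hx, hy⟩, rfl⟩
    exact (mem_region x y).mpr ⟨(abs_le.mpr hx).trans_lt hρ1, (abs_le.mpr hy).trans_lt hρ1⟩
  have h0K : (0 : ℂ) ∈ K := by
    simpa using memK 0 0 (by norm_num) (by norm_num)
  obtain ⟨z₀, hz₀, hmax⟩ := hKc.exists_isMaxOn ⟨0, h0K⟩
    ((hFd.continuousOn.mono hKsub).norm)
  have hmax' : IsMaxOn (norm ∘ F) (kronRegion τ ρ) z₀ := by
    intro z hz
    by_cases hz1 : z = 0
    · rw [hz1]; exact hmax h0K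
    obtain ⟨x, y, rfl⟩ := exists_coords hτ z
    obtain ⟨hx, hy⟩ := (mem_region x y).mp hz
    obtain ⟨x', y', hx', hy', hne, he⟩ := exists_norm_kronDiff_eq (μ := μ) hτ (hx.trans hρ)
      (hy.trans hρ) hz1
    have := hmax (memK x' y' hx' hy')
    simp only [Set.mem_ofPred_eq, Function.comp] at this ⊢
    rwa [hFne _ hz1, he, ← hFne _ hne]
  have hconst := Complex.eqOn_of_isPreconnected_of_isMaxOn_norm
    (convex_kronRegion τ ρ).isPreconnected (isOpen_kronRegion τ ρ) hFd (hKsub hz₀) hmax'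
  have hval : ∀ z, z ≠ 0 → z ∈ kronRegion τ ρ → kronDiff τ μ z = F z₀ := by
    intro z hz hz'
    rw [← hFne z hz]; exact hconst hz'
  have hhalf : ((1 / 2 : ℝ) : ℂ) ∈ kronRegion τ ρ := by
    simpa using (mem_region (1 / 2) 0).mpr
      ⟨by rw [abs_of_pos (by norm_num)]; linarith, by rw [abs_zero]; linarith⟩
  have hhalf' : ((-(1 / 2) : ℝ) : ℂ) ∈ kronRegion τ ρ := by
    simpa using (mem_region (-(1 / 2)) 0).mpr
      ⟨by rw [abs_neg, abs_of_pos (by norm_num)]; linarith, by rw [abs_zero]; linarith⟩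
  have v1 := hval _ (by norm_num) hhalf
  have v2 := hval _ (by norm_num) hhalf'
  rw [hval a ha0 ha]
  by_cases h : ee (μ : ℂ) = 1
  · obtain ⟨hm1, hm2⟩ := hhalf
    simp only [Set.mem_ofPred_eq] at hm1 hm2
    have h3 := one_sub_ee_ne_zero_of_mem hτ (a := ((1 / 2 : ℝ) : ℂ)) (by norm_num)
      (by nlinarith) (by nlinarith)
    have h4 := kronDiff_neg h h3.1 h3.2
    rw [← Complex.ofReal_neg, v1, v2] at h4
    linear_combination (1 / 2) * h4
  · have him : (I / τ * ((-(1 / 2) : ℝ) : ℂ)).im = -(1 / 2) * (I / τ).im := by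
      simpa using im_mul_coords hτ (-(1 / 2)) 0
    have h4 := kronDiff_add_one hτ (μ := μ) (a := ((-(1 / 2) : ℝ) : ℂ))
      (by rw [him]; linarith) (by rw [him]; linarith)
    rw [show ((-(1 / 2) : ℝ) : ℂ) + 1 = ((1 / 2 : ℝ) : ℂ) by push_cast; ring, v1, v2] at h4
    have h5 : ee (-μ) ≠ 1 := by rwa [Ne, ee_neg_eq_one_iff]
    have h6 : (1 - ee (-μ)) * F z₀ = 0 := by linear_combination h4
    exact (mul_eq_zero.mp h6).resolve_left (sub_ne_zero.mpr h5.symm)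
end kron

/-- The exponential generating function of the power moments `∑ c_i λ_i^K`. -/
lemma hasSum_moments {ι : Type*} (c lam : ι → ℂ) (W : ℂ)
    (h : Summable fun i => ‖c i‖ * Real.exp (‖lam i‖ * ‖W‖)) :
    HasSum (fun K : ℕ => (∑' i, c i * lam i ^ K) * W ^ K / (Nat.factorial K : ℂ))
      (∑' i, c i * Complex.exp (lam i * W)) := by
  have hexp : ∀ i, HasSum (fun K : ℕ => c i * ((lam i * W) ^ K / (Nat.factorial K : ℂ)))
      (c i * Complex.exp (lam i * W)) := by
    intro i
    have := NormedSpace.expSeries_div_hasSum_exp (lam i * W)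
    rw [← Complex.exp_eq_exp_ℂ] at this
    exact this.mul_left _
  have hexpr : ∀ i, HasSum (fun K : ℕ => ‖c i * ((lam i * W) ^ K / (Nat.factorial K : ℂ))‖)
      (‖c i‖ * Real.exp (‖lam i‖ * ‖W‖)) := by
    intro i
    have := NormedSpace.expSeries_div_hasSum_exp (‖lam i‖ * ‖W‖)
    rw [← Real.exp_eq_exp_ℝ] at this
    refine (this.mul_left ‖c i‖).congr_fun fun K => ?_
    simp [mul_pow]
  have hs : Summable fun p : ι × ℕ => c p.1 * ((lam p.1 * W) ^ p.2 / (Nat.factorial p.2 : ℂ)) := by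
    refine Summable.of_norm ?_
    rw [summable_prod_of_nonneg (fun _ => norm_nonneg _)]
    refine ⟨fun i => (hexpr i).summable, ?_⟩
    simpa only [fun i => (hexpr i).tsum_eq] using h
  have h1 := hs.hasSum.prod_fiberwise hexp
  rw [h1.tsum_eq]
  have hs' := (Equiv.prodComm ℕ ι).summable_iff.mpr hs
  have h2 := ((Equiv.prodComm ℕ ι).hasSum_iff.mpr hs.hasSum).prod_fiberwise
    (fun K => (hs'.prod_factor K).hasSum)
  refine h2.congr_fun fun K => ?_
  rw [mul_div_assoc, ← tsum_mul_right]
  refine tsum_congr fun i => ?_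
  simp only [Function.comp, Equiv.prodComm_apply, Prod.swap]
  rw [mul_pow]; ring

lemma ee_eq_exp (a : ℂ) : ee a = Complex.exp (2 * π * I * a) := rfl

lemma hasSum_geoTerm {b : ℝ} {w : ℂ} (hw : 0 < w.im) :
    HasSum (fun j : ℕ => ee ((b + j) * w)) (geoTerm b w) := by
  have h : ‖ee w‖ < 1 := by
    rw [norm_ee, Real.exp_lt_one_iff]; nlinarith [mul_pos Real.pi_pos hw]
  refine ((hasSum_geometric_of_norm_lt_one h).mul_left (ee (b * w))).congr_fun fun j => ?_
  rw [add_mul, ee_add, ee_natCast_mul]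

/-- The exponential generating function of the series `𝒮_{-K}`. -/
lemma hasSum_Scal_neg (γ δ' κ lam : ℝ) {t : ℂ} (ht : 0 < t.re) {W : ℂ}
    (hW : ‖W‖ < 2 * π * t.re * fracP γ) :
    HasSum (fun K : ℕ => Scal ((-(K : ℤ) : ℤ) : ℂ) γ δ' κ lam t * W ^ K / (Nat.factorial K : ℂ))
      (∑' i : ℕ, ee ((fracP γ + i) * κ) *
        geoTerm (fracP δ') (lam + W / (2 * π * I) + I * t * (fracP γ + i))) := by
  have hpi := Real.pi_pos
  have hb := fracP_pos δ'
  have hg := fracP_pos γ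
  set c : ℕ × ℕ → ℂ := fun p => ee (((fracP γ + p.1) * κ + (fracP δ' + p.2) * lam : ℝ) : ℂ) *
    Complex.exp (-2 * (π : ℂ) * t * ((fracP γ + p.1 : ℝ) : ℂ) * ((fracP δ' + p.2 : ℝ) : ℂ))
    with hc
  have hbpos : ∀ j : ℕ, 0 < fracP δ' + j := fun j => by positivity
  have hnc : ∀ p, ‖c p‖ = Real.exp (-(2 * π * t.re) * (fracP γ + p.1) * (fracP δ' + p.2)) := by
    intro p
    rw [hc, norm_mul, norm_ee_ofReal, one_mul, Complex.norm_exp, mul_assoc, ← Complex.ofReal_mul,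
      Complex.re_mul_ofReal]
    congr 1
    simp
    ring
  have hs0 : Summable c := by
    refine Summable.of_norm ?_
    refine (summable_exp_bilinear (a := fracP γ) hb (c := 2 * π * t.re) (ρ := 0) (by positivity)
      (by positivity)).congr fun p => ?_
    rw [hnc]; congr 1; ring
  have hs : Summable fun p : ℕ × ℕ => ‖c p‖ *
      Real.exp (‖((fracP δ' + p.2 : ℝ) : ℂ)‖ * ‖W‖) := by
    refine (summable_exp_bilinear hb (by positivity) hW).congr fun p => ?_
    rw [hnc, ← Real.exp_add, Complex.norm_real, Real.norm_of_nonneg (hbpos _).le]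
    congr 1; ring
  have hm := hasSum_moments c (fun p => ((fracP δ' + p.2 : ℝ) : ℂ)) W hs
  have hsK : ∀ K : ℕ, Summable fun p : ℕ × ℕ => c p * ((fracP δ' + p.2 : ℝ) : ℂ) ^ K := by
    intro K
    -- the moments are dominated by exponentials
    obtain ⟨ρ, hρ0, hρ⟩ : ∃ ρ : ℝ, 0 < ρ ∧ ρ < 2 * π * t.re * fracP γ :=
      exists_between (by positivity)
    have hs1 := (summable_exp_bilinear hb (c := 2 * π * t.re) (by positivity) hρ).mul_left
      ((Nat.factorial K : ℝ) / ρ ^ K)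
    refine Summable.of_norm_bounded hs1 fun p => ?_
    rw [norm_mul, hnc, norm_pow, Complex.norm_real, Real.norm_of_nonneg (hbpos _).le,
      Real.exp_add, mul_left_comm]
    refine mul_le_mul_of_nonneg_left ?_ (Real.exp_nonneg _)
    have := Real.pow_div_factorial_le_exp (ρ * (fracP δ' + p.2)) (by positivity) K
    have hf : (0 : ℝ) < Nat.factorial K := by positivity
    rw [div_le_iff₀ hf, mul_pow] at this
    rw [div_mul_eq_mul_div, le_div_iff₀ (by positivity)]
    linarith
  have hval : ∑' p : ℕ × ℕ, c p * Complex.exp (((fracP δ' + p.2 : ℝ) : ℂ) * W) =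
      ∑' i : ℕ, ee ((fracP γ + i) * κ) *
        geoTerm (fracP δ') (lam + W / (2 * π * I) + I * t * (fracP γ + i)) := by
    have hsum : Summable fun p : ℕ × ℕ =>
        c p * Complex.exp (((fracP δ' + p.2 : ℝ) : ℂ) * W) := by
      refine Summable.of_norm_bounded hs fun p => ?_
      rw [norm_mul]
      refine mul_le_mul_of_nonneg_left ?_ (norm_nonneg _)
      rw [Complex.norm_exp, ← norm_mul, Real.exp_le_exp]
      exact Complex.re_le_norm _
    rw [hsum.tsum_prod]
    refine tsum_congr fun i => ?_
    have him : 0 < ((lam : ℂ) + W / (2 * π * I) + I * t * (fracP γ + i)).im := by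
      have h1 : ((lam : ℂ) + W / (2 * π * I) + I * t * (fracP γ + i)).im =
          - W.re / (2 * π) + t.re * (fracP γ + i) := by
        have e1 : W / (2 * π * I) = ((1 / (2 * π) : ℝ) : ℂ) * (-I * W) := by
          have : (π : ℂ) ≠ 0 := by exact_mod_cast hpi.ne'
          push_cast; field_simp; linear_combination W * I_sq
        have e2 : I * t * (fracP γ + i) = ((fracP γ + i : ℝ) : ℂ) * (I * t) := by push_cast; ring
        rw [e1, e2, Complex.add_im, Complex.add_im, Complex.im_ofReal_mul, Complex.im_ofReal_mul]
        simp; ring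
      rw [h1]
      have h2 := Complex.re_le_norm W
      have h3 : W.re < 2 * π * (t.re * (fracP γ + i)) := by
        have : 0 ≤ 2 * π * (t.re * i) := by positivity
        nlinarith
      have h4 : W.re / (2 * π) < t.re * (fracP γ + i) := by
        rw [div_lt_iff₀ (by positivity)]; linarith
      rw [neg_div]; linarith
    rw [← (hasSum_geoTerm him).tsum_eq, ← tsum_mul_left]
    refine tsum_congr fun j => ?_
    rw [hc]
    simp only [ee_eq_exp, ← Complex.exp_add]
    congr 1
    have : (π : ℂ) ≠ 0 := by exact_mod_cast hpi.ne'
    push_cast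
    field_simp
    linear_combination (-2 * π * t * (fracP γ + i) * (fracP δ' + j)) * I_sq
  rw [hval] at hm
  refine hm.congr_fun fun K => ?_
  congr 2
  rw [Scal_eq_tsum_nat, (hsK K).tsum_prod]
  refine tsum_congr fun i => tsum_congr fun j => ?_
  rw [neg_neg, zpow_natCast]; ring

lemma hasSum_shift {a : ℕ → ℂ} {W G : ℂ} (hW : W ≠ 0) (h : HasSum (fun j => a j * W ^ j) G) :
    HasSum (fun K => a (K + 1) * W ^ K) ((G - a 0) / W) := by
  have h1 := (hasSum_nat_add_iff' (f := fun j => a j * W ^ j) 1).mpr h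
  rw [Finset.sum_range_one, pow_zero, mul_one] at h1
  refine (h1.div_const W).congr_fun fun K => ?_
  rw [pow_succ]
  field_simp

lemma tendsto_mul_punctured {s : ℂ} (hs : s ≠ 0) :
    Tendsto (fun W : ℂ => s * W) (𝓝[≠] 0) (𝓝[≠] 0) := by
  rw [tendsto_nhdsWithin_iff]
  constructor
  · have : Continuous fun W : ℂ => s * W := by fun_prop
    simpa using (this.tendsto 0).mono_left nhdsWithin_le_nhds
  · filter_upwards [self_mem_nhdsWithin] with W hW
    exact mul_ne_zero hs hW

lemma geoTerm_shift {α β μ P : ℝ} (h1 : ∃ n : ℤ, α = β + n) (h2 : ∃ m : ℤ, P = -μ + m) (w : ℂ) :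
    ee (α * μ) * geoTerm P (α + w) = ee (β * μ) * geoTerm P (β + w) := by
  obtain ⟨n, rfl⟩ := h1
  obtain ⟨m, rfl⟩ := h2
  have e1 : ee (((β + n : ℝ) : ℂ) + w) = ee (β + w) := by
    rw [← ee_add_intCast (β + w) n]; congr 1; push_cast; ring
  rw [geoTerm, geoTerm, e1, ← mul_div_assoc, ← mul_div_assoc, ← ee_add, ← ee_add,
    ← ee_add_intCast (β * μ + _) (n * m)]
  congr 2
  push_cast; ring

section gen

variable {C : ℕ → ℂ → ℝ → ℂ}
    (hC : ∀ (X : ℂ) (κ : ℝ), ∀ᶠ Z in nhdsWithin (0 : ℂ) {(0 : ℂ)}ᶜ,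
      HasSum (fun j : ℕ => C j X κ * Z ^ j / (Nat.factorial j : ℂ))
        (Z * ee (X * (κ : ℂ)) * Complex.exp (X * Z) / (ee ((κ : ℝ) : ℂ) * Complex.exp Z - 1)))

include hC

lemma hasSum_zeta_neg : ∀ᶠ W in 𝓝[≠] (0 : ℂ),
    HasSum (fun K : ℕ => riemannZeta ((-(K : ℤ) : ℤ) : ℂ) * W ^ K / (Nat.factorial K : ℂ))
      (geoTerm 1 (W / (2 * π * I)) + 1 / W) := by
  have h := punctHasSum_genC hC 0 0
  rw [genC_zero_of_ee_eq_one hC (by simp [ee_zero])] at h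
  have ht := tendsto_mul_punctured (s := -1) (by norm_num)
  filter_upwards [ht.eventually h, self_mem_nhdsWithin,
    ht.eventually (eventually_ee_mul_exp_ne_one 0)] with W hW hW0 hne
  have hW0 : W ≠ 0 := hW0
  simp only [bernoulliPowerSeries, PowerSeries.coeff_mk, neg_one_mul, ee_zero, one_mul, mul_zero,
    zero_mul, Complex.ofReal_zero, Complex.exp_zero, mul_one] at hW hne
  have h1 := (hasSum_shift (neg_ne_zero.mpr hW0) hW)
  have hval : geoTerm 1 (W / (2 * π * I)) + 1 / W = (-W / (Complex.exp (-W) - 1) -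
      (algebraMap ℚ ℂ) (bernoulli 0 / (Nat.factorial 0 : ℚ))) / -W := by
    have e1 : ee (W / (2 * π * I)) = Complex.exp W := by
      rw [ee_eq_exp, mul_div_cancel₀ _ Complex.two_pi_I_ne_zero]
    rw [geoTerm, Complex.ofReal_one, one_mul, e1]
    have h3 := Complex.exp_ne_zero W
    rw [Complex.exp_neg] at hne ⊢
    have h4 : 1 - Complex.exp W ≠ 0 := by
      intro h; apply hne; field_simp; rw [h, mul_zero]
    simp
    field_simp
    ring
  rw [hval]
  refine h1.congr_fun fun K => ?_
  have : riemannZeta ((-(K : ℤ) : ℤ) : ℂ) = (-1) ^ K * bernoulli (K + 1) / (K + 1) := by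
    rw [← riemannZeta_neg_nat_eq_bernoulli]; push_cast; rfl
  rw [this, Nat.factorial_succ, neg_pow W K]
  have hK : (K : ℂ) + 1 ≠ 0 := by exact_mod_cast Nat.succ_ne_zero K
  have hf : (Nat.factorial K : ℂ) ≠ 0 := by exact_mod_cast Nat.factorial_ne_zero K
  simp
  field_simp

lemma hasSum_psi_neg (α μ : ℝ) : ∀ᶠ W in 𝓝[≠] (0 : ℂ),
    HasSum (fun K : ℕ => ee (α * μ) * psiIntC C (-(K : ℤ)) (-μ) α * W ^ K / (Nat.factorial K : ℂ))
      (ee (Int.fract α * μ) * geoTerm (fracP (-μ)) (Int.fract α + W / (2 * π * I)) +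
        dInt α / W) := by
  set X : ℝ := Int.fract (-μ) with hX
  have h := hC X α
  filter_upwards [h, self_mem_nhdsWithin, eventually_ee_mul_exp_ne_one α] with W hW hW0 hne
  have hW0 : W ≠ 0 := hW0
  have h1 := hasSum_shift (a := fun j => C j X α / (Nat.factorial j : ℂ)) hW0
    (hW.congr_fun fun j => by ring)
  have h2 : HasSum (fun K : ℕ => (if K = 0 then dInt (-μ) else 0 : ℂ)) (dInt (-μ)) :=
    hasSum_ite_eq 0 _
  have h3 := ((h1.neg.sub h2).mul_left (ee (α * μ)))
  have hval : ee (Int.fract α * μ) * geoTerm (fracP (-μ)) (Int.fract α + W / (2 * π * I)) +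
      dInt α / W = ee (α * μ) * (-((W * ee (X * α) * Complex.exp (X * W) /
        (ee α * Complex.exp W - 1) - C 0 X α / (Nat.factorial 0 : ℂ)) / W) - dInt (-μ)) := by
    have hv : Complex.exp W = ee (W / (2 * π * I)) := by
      rw [ee_eq_exp, mul_div_cancel₀ _ Complex.two_pi_I_ne_zero]
    have hXv : Complex.exp (X * W) = ee (X * (W / (2 * π * I))) := by
      rw [ee_eq_exp, mul_left_comm, mul_div_cancel₀ _ Complex.two_pi_I_ne_zero]
    rw [hv, ← ee_add] at hne
    rw [hv, hXv, ← ee_add, C_zero hC]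
    set v := W / (2 * π * I) with hvdef
    have hg : 1 - ee (α + v) ≠ 0 := fun h => hne (by linear_combination -h)
    have e1 : W * ee (X * α) * ee (X * v) / (ee (α + v) - 1) = -(W * geoTerm X (α + v)) := by
      rw [geoTerm, mul_add, ee_add (X * α)]
      field_simp
      ring
    have hXm : ∃ m : ℤ, X = -μ + m := ⟨-⌊-μ⌋, by rw [hX, Int.fract]; push_cast; ring⟩
    have e2 := geoTerm_shift (μ := μ) (P := X) ⟨⌊α⌋, (Int.fract_add_floor α).symm⟩ hXm v
    have e3 : ee (α * μ) * ee (X * α) * dInt α = dInt α := by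
      rw [dInt]
      split_ifs with hα
      · obtain ⟨n, rfl⟩ := hα
        obtain ⟨m, hm⟩ := hXm
        rw [← ee_add, hm, mul_one]
        have := ee_intCast (n * m)
        rw [← this]; congr 1; push_cast; ring
      · simp
    have e4 : geoTerm (fracP (-μ)) (Int.fract α + v) =
        geoTerm X (Int.fract α + v) - dInt (-μ) := by
      rw [dInt_eq_ite]
      split_ifs with hμ
      · have hX0 : X = 0 := by
          obtain ⟨n, hn⟩ := (ee_eq_one_iff _).mp hμ
          have hn' : -μ = n := by exact_mod_cast hn
          rw [hX, hn', Int.fract_intCast]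
        have e5 : ee (Int.fract α + v) = ee (α + v) := by
          rw [← ee_add_intCast _ ⌊α⌋]; congr 1
          rw [← Complex.ofReal_intCast, add_right_comm, ← Complex.ofReal_add, Int.fract_add_floor]
        rw [fracP_eq_one_of_ee_eq_one hμ, hX0, geoTerm, geoTerm, e5]
        simp only [Complex.ofReal_one, one_mul, Complex.ofReal_zero, zero_mul, ee_zero, e5]
        field_simp
        ring
      · rw [sub_zero]
        rw [Complex.ofReal_neg, ee_neg_eq_one_iff] at hμ
        congr 1
        have := fracP_neg_add_fracP_of_ee_ne_one hμ
        rw [hX, fract_neg_eq_one_sub_fracP]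
        linarith
    have e6 : ee (Int.fract α * μ) * dInt (-μ) = ee (α * μ) * dInt (-μ) := by
      rw [dInt]
      split_ifs with hμ
      · obtain ⟨n, hn⟩ := hμ
        have : μ = ((-n : ℤ) : ℝ) := by push_cast; linarith
        rw [this, mul_one, mul_one, ← ee_add_intCast (Int.fract α * _) (⌊α⌋ * -n)]
        congr 1
        rw [Int.fract]; push_cast; ring
      · simp
    rw [e1, e4]
    simp only [Nat.factorial_zero, Nat.cast_one, div_one]
    have hE : ee (α * μ) ≠ 0 := ee_ne_zero _
    generalize ee (α * μ) = E at *
    generalize ee (Int.fract α * μ) = E' at *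
    generalize ee (X * α) = E'' at *
    field_simp
    linear_combination (-W) * e2 - W * e6 - e3
  rw [hval]
  refine h3.congr_fun fun K => ?_
  rw [psiIntC, if_neg (by omega), if_pos (by omega),
    show (1 - -(K : ℤ)).toNat = K + 1 by omega, Nat.factorial_succ]
  have hK : (K : ℂ) + 1 ≠ 0 := by exact_mod_cast Nat.succ_ne_zero K
  have hf : (Nat.factorial K : ℂ) ≠ 0 := by exact_mod_cast Nat.factorial_ne_zero K
  rcases Nat.eq_zero_or_pos K with rfl | hK0
  · simp [hX]
  · rw [if_neg (by omega), if_neg (by omega)]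
    push_cast
    rw [sub_neg_eq_add, add_comm (1 : ℂ)]
    field_simp
    ring
end gen

lemma eventually_norm_lt {c : ℝ} (hc : 0 < c) : ∀ᶠ W in 𝓝[≠] (0 : ℂ), ‖W‖ < c := by
  have : ∀ᶠ W in 𝓝 (0 : ℂ), ‖W‖ < c := by
    filter_upwards [Metric.ball_mem_nhds (0 : ℂ) hc] with W hW
    simpa using hW
  exact this.filter_mono nhdsWithin_le_nhds

lemma neg_one_zpow_neg_sub_one (K : ℕ) : (-1 : ℂ) ^ (-(K : ℤ) - 1) = -(-1) ^ K := by
  rw [zpow_sub₀ (by norm_num), zpow_neg, zpow_natCast, zpow_one]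
  rcases neg_one_pow_eq_or ℂ K with h | h <;> rw [h] <;> norm_num

lemma eventually_kronDiff_eq_zero {τ : ℂ} (hτ : 0 < τ.re) (α μ : ℝ) :
    ∀ᶠ W in 𝓝[≠] (0 : ℂ), kronDiff τ μ (Int.fract α + W / (2 * π * I)) = 0 := by
  set f := Int.fract α with hf
  have hf0 : 0 ≤ f := Int.fract_nonneg α
  have hf1 : f < 1 := Int.fract_lt_one α
  obtain ⟨ρ, hρ1, hρ2⟩ : ∃ ρ, max (1 / 2) f < ρ ∧ ρ < 1 := exists_between (by
    rw [max_lt_iff]; exact ⟨by norm_num, hf1⟩)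
  rw [max_lt_iff] at hρ1
  have hcont : Continuous fun W : ℂ => (f : ℂ) + W / (2 * π * I) := by fun_prop
  have hp := im_I_div_pos hτ
  have hmem : (f : ℂ) + 0 / (2 * π * I) ∈ kronRegion τ ρ := by
    rw [zero_div, add_zero]
    refine ⟨?_, ?_⟩
    · rw [Set.mem_ofPred_eq, Complex.ofReal_im, abs_zero]
      exact mul_pos (by linarith) hτ
    · rw [Set.mem_ofPred_eq, Complex.im_mul_ofReal, abs_of_nonneg (mul_nonneg hp.le hf0), mul_comm]
      exact mul_lt_mul_of_pos_right hρ1.2 hp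
  have h1 := (hcont.tendsto 0).eventually ((isOpen_kronRegion τ ρ).mem_nhds hmem)
  have h2 : ∀ᶠ W in 𝓝[≠] (0 : ℂ), (f : ℂ) + W / (2 * π * I) ≠ 0 := by
    rcases hf0.eq_or_lt with h | h
    · filter_upwards [self_mem_nhdsWithin] with W hW
      rw [← h, Complex.ofReal_zero, zero_add]
      exact div_ne_zero hW Complex.two_pi_I_ne_zero
    · have : (f : ℂ) + 0 / (2 * π * I) ≠ 0 := by
        rw [zero_div, add_zero]; exact_mod_cast h.ne'
      exact ((hcont.tendsto 0).eventually_ne this).filter_mono nhdsWithin_le_nhds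
  filter_upwards [h1.filter_mono nhdsWithin_le_nhds, h2] with W hW1 hW2
  exact kronDiff_eq_zero hτ hW2 hρ1.1 hρ2 hW1

lemma hasSum_ee_mul_Scal_neg {τ : ℂ} (hτ : 0 < τ.re) {α β : ℝ} (μ : ℝ) (h : ∃ n : ℤ, α = β + n) :
    ∀ᶠ W in 𝓝[≠] (0 : ℂ),
      HasSum (fun K : ℕ => ee (α * μ) * Scal ((-(K : ℤ) : ℤ) : ℂ) 0 (-μ) 0 α τ * W ^ K /
          (Nat.factorial K : ℂ))
        (ee (β * μ) * geoSeries 1 (fracP (-μ)) (I * τ) (β + W / (2 * π * I))) := by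
  have hpos : 0 < 2 * π * τ.re * fracP 0 := by
    have := Real.pi_pos; rw [fracP_zero]; positivity
  filter_upwards [eventually_norm_lt hpos] with W hW
  have h1 := (hasSum_Scal_neg 0 (-μ) 0 α hτ hW).mul_left (ee (α * μ))
  have hval : ee (β * μ) * geoSeries 1 (fracP (-μ)) (I * τ) (β + W / (2 * π * I)) =
      ee (α * μ) * ∑' i : ℕ, ee ((fracP 0 + i) * (0 : ℝ)) *
        geoTerm (fracP (-μ)) (α + W / (2 * π * I) + I * τ * (fracP 0 + i)) := by
    rw [geoSeries, ← tsum_mul_left, ← tsum_mul_left]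
    refine tsum_congr fun i => ?_
    have := geoTerm_shift (μ := μ) h ⟨_, fracP_eq_add_intCast (-μ)⟩
      (W / (2 * π * I) + I * τ * (1 + i))
    rw [fracP_zero, Complex.ofReal_zero, mul_zero, ee_zero, one_mul, one_pow, one_mul, add_assoc,
      add_assoc, Complex.ofReal_one, this, add_comm (i : ℂ)]
  rw [hval]
  exact h1.congr_fun fun K => by ring

lemma hasSum_dual_Scal_neg {τ : ℂ} (hτ : 0 < τ.re) (α μ : ℝ) :
    ∀ᶠ W in 𝓝[≠] (0 : ℂ),
      HasSum (fun K : ℕ => Scal ((-(K : ℤ) : ℤ) : ℂ) α 0 μ 0 (1 / τ) * (I / τ * W) ^ K /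
          (Nat.factorial K : ℂ))
        (∑' i : ℕ, ee ((fracP α + i) * μ) *
          geoTerm 1 (I / τ * (W / (2 * π * I) + fracP α + i))) := by
  have h0 : τ ≠ 0 := by rintro rfl; simp at hτ
  have hτ' : 0 < (1 / τ).re := by
    have := Complex.normSq_pos.mpr h0
    rw [one_div, Complex.inv_re]; positivity
  have hpos : 0 < 2 * π * (1 / τ).re * fracP α := by
    have := Real.pi_pos; have := fracP_pos α; positivity
  have hs : I / τ ≠ 0 := div_ne_zero I_ne_zero h0
  filter_upwards [(tendsto_mul_punctured hs).eventually (eventually_norm_lt hpos)] with W hW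
  have h1 := hasSum_Scal_neg α 0 μ 0 hτ' hW
  have hval : ∑' i : ℕ, ee ((fracP α + i) * μ) *
        geoTerm 1 (I / τ * (W / (2 * π * I) + fracP α + i)) =
      ∑' i : ℕ, ee ((fracP α + i) * μ) * geoTerm (fracP 0) (((0 : ℝ) : ℂ) +
        I / τ * W / (2 * π * I) + I * (1 / τ) * (fracP α + i)) := by
    refine tsum_congr fun i => ?_
    rw [fracP_zero, Complex.ofReal_zero]
    congr 2
    ring
  rw [hval]
  exact h1

lemma dInt_eq_zero_or (α : ℝ) :
    (dInt α = 1 ∧ Int.fract α = 0 ∧ fracP α = 1) ∨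
      (dInt α = 0 ∧ fracP α = Int.fract α ∧ 0 < Int.fract α) := by
  rw [dInt]
  split_ifs with h
  · obtain ⟨n, rfl⟩ := h
    left
    simp [fracP, ← Int.cast_neg]
  · right
    have h1 : Int.fract α ≠ 0 := by
      intro h0
      apply h
      rw [Int.fract_eq_iff] at h0
      obtain ⟨-, -, z, hz⟩ := h0
      exact ⟨z, by linarith⟩
    refine ⟨rfl, ?_, (Int.fract_nonneg α).lt_of_ne' h1⟩
    rw [fracP, Int.fract_neg h1]; ring

lemma im_mul_fract_add {τ : ℂ} (hτ : 0 < τ.re) (α : ℝ) :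
    ∀ᶠ W in 𝓝[≠] (0 : ℂ), -(I / τ).im < (I / τ * (Int.fract α + W / (2 * π * I))).im := by
  have hcont : Continuous fun W : ℂ => (I / τ * (Int.fract α + W / (2 * π * I))).im :=
    Complex.continuous_im.comp (by fun_prop)
  have h := hcont.tendsto 0
  have hp := im_I_div_pos hτ
  rw [zero_div, add_zero, Complex.im_mul_ofReal] at h
  refine (h.eventually_const_lt ?_).filter_mono nhdsWithin_le_nhds
  have := mul_nonneg hp.le (Int.fract_nonneg α)
  linarith

lemma dual_tsum_pos {τ : ℂ} (hτ : 0 < τ.re) (α μ : ℝ) {W : ℂ}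
    (hW : -(I / τ).im < (I / τ * (Int.fract α + W / (2 * π * I))).im) :
    dInt α * geoTerm 1 (I / τ * (W / (2 * π * I))) + ∑' i : ℕ, ee ((fracP α + i) * μ) *
        geoTerm 1 (I / τ * (W / (2 * π * I) + fracP α + i)) =
      ee (Int.fract α * μ) * (geoTerm 1 (I / τ * (Int.fract α + W / (2 * π * I))) +
        geoSeries (ee μ) 1 (I / τ) (I / τ * (Int.fract α + W / (2 * π * I)))) := by
  rw [geoSeries]
  rcases dInt_eq_zero_or α with ⟨h1, h2, h3⟩ | ⟨h1, h2, -⟩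
  · rw [h1, h2, h3, Complex.ofReal_zero, zero_mul, ee_zero, one_mul, one_mul, zero_add]
    congr 1
    refine tsum_congr fun i => ?_
    rw [← ee_natCast_mul]
    congr 2
    · push_cast; ring
    · push_cast; ring
  · have hs := summable_geoSeries (c := ee μ) (P := 1) (norm_ee_ofReal μ) one_pos
      (im_I_div_pos hτ) hW
    have hterm : ∀ i : ℕ, ee ((Int.fract α + i) * μ) *
        geoTerm 1 (I / τ * (W / (2 * π * I) + Int.fract α + i)) = ee (Int.fract α * μ) *
          (ee μ ^ i * geoTerm 1 (I / τ * (Int.fract α + W / (2 * π * I)) + I / τ * i)) := by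
      intro i
      rw [← ee_natCast_mul, ← mul_assoc, ← ee_add]
      congr 2 <;> ring
    rw [h1, h2, zero_mul, zero_add, tsum_congr hterm, tsum_mul_left, tsum_eq_zero_add']
    · simp
    · simpa using hs

lemma dual_tsum_neg {τ : ℂ} (α μ : ℝ) (W : ℂ) :
    ∑' i : ℕ, ee ((fracP (-α) + i) * (-μ : ℝ)) *
        geoTerm 1 (I / τ * (-W / (2 * π * I) + fracP (-α) + i)) =
      ee (Int.fract α * μ) *
        geoSeries (ee μ)⁻¹ 1 (I / τ) (-(I / τ * (Int.fract α + W / (2 * π * I)))) := by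
  rw [geoSeries, ← tsum_mul_left]
  refine tsum_congr fun i => ?_
  have : fracP (-α) = 1 - Int.fract α := by rw [fracP, neg_neg]
  rw [this, ← ee_neg, ← ee_natCast_mul, ← mul_assoc, ← ee_add]
  congr 2
  · push_cast; ring
  · push_cast; ring

section gen

variable {C : ℕ → ℂ → ℝ → ℂ}
    (hC : ∀ (X : ℂ) (κ : ℝ), ∀ᶠ Z in nhdsWithin (0 : ℂ) {(0 : ℂ)}ᶜ,
      HasSum (fun j : ℕ => C j X κ * Z ^ j / (Nat.factorial j : ℂ))
        (Z * ee (X * (κ : ℂ)) * Complex.exp (X * Z) / (ee ((κ : ℝ) : ℂ) * Complex.exp Z - 1)))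

/-- The polynomial correction term in the transformation formula of the pair `ψ(k)`, `ζ(k)`. -/
def corr (C : ℕ → ℂ → ℝ → ℂ) (k : ℤ) (X : ℂ) (μ : ℝ) (τ : ℂ) : ℂ :=
  (-2 * (Real.pi : ℂ)) ^ k *
          ∑ j ∈ Finset.range (k + 2).toNat,
            (-Complex.I) ^ j * C j X μ *
                ((bernoulli ((k + 1).toNat - j) : ℚ) : ℂ) /
                ((Nat.factorial j : ℂ) * (Nat.factorial ((k + 1).toNat - j) : ℂ)) *
              τ ^ (k - (j : ℤ))

include hC

lemma hasSum_corr {τ : ℂ} (h0 : τ ≠ 0) (X : ℂ) (μ : ℝ) (W : ℂ) :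
    HasSum (fun K : ℕ => corr C (-(K : ℤ)) X μ τ * W ^ K / (Nat.factorial K : ℂ))
      (-(ee (X * μ) * (dInt μ / 2 + I / τ * (if ee (μ : ℂ) = 1 then X + W / (2 * π * I) - 1 / 2
        else 1 / (ee (μ : ℂ) - 1))))) := by
  have h := hasSum_sum_of_ne_finset_zero (L := SummationFilter.unconditional ℕ)
    (f := fun K : ℕ => corr C (-(K : ℤ)) X μ τ * W ^ K / (Nat.factorial K : ℂ))
    (s := Finset.range 2) (by
      intro K hK
      rw [Finset.mem_range, not_lt] at hK
      have : (-(K : ℤ) + 2).toNat = 0 := by omega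
      simp [corr, this])
  have hpi : (π : ℂ) ≠ 0 := by exact_mod_cast Real.pi_ne_zero
  have hval : -(ee (X * μ) * (dInt μ / 2 + I / τ * (if ee (μ : ℂ) = 1 then
      X + W / (2 * π * I) - 1 / 2 else 1 / (ee (μ : ℂ) - 1)))) =
      ∑ K ∈ Finset.range 2, corr C (-(K : ℤ)) X μ τ * W ^ K / (Nat.factorial K : ℂ) := by
    rw [Finset.sum_range_succ, Finset.sum_range_one]
    simp only [corr, Nat.cast_zero, neg_zero, Nat.cast_one]
    rw [show ((0 : ℤ) + 2).toNat = 2 by rfl, show ((0 : ℤ) + 1).toNat = 1 by rfl,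
      show (-(1 : ℤ) + 2).toNat = 1 by rfl, show (-(1 : ℤ) + 1).toNat = 0 by rfl,
      Finset.sum_range_succ, Finset.sum_range_one, Finset.sum_range_one, C_zero hC, C_one hC,
      dInt_eq_ite]
    simp only [zpow_neg, zpow_one, zpow_zero, Nat.cast_zero, Nat.cast_one, sub_zero, zero_sub,
      bernoulli_zero, pow_zero, pow_one, Nat.factorial, Nat.sub_self]
    split_ifs with hμ
    · simp
      field_simp
      ring
    · simp
      field_simp
  rw [hval]
  exact h

/-- The transformation formula for `ψ(k,-μ,α)` and `ζ(k)`, `k ≤ 0`. -/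
theorem transformation_neg (α μ : ℝ) {τ : ℂ} (hτ : 0 < τ.re) (K : ℕ) :
    ee ((α * μ : ℝ) : ℂ) *
          (psiIntC C (-(K : ℤ)) (-μ) α + Scal ((-(K : ℤ) : ℤ) : ℂ) 0 (-μ) 0 α τ +
            (-1 : ℂ) ^ (-(K : ℤ) - 1) * Scal ((-(K : ℤ) : ℤ) : ℂ) 0 μ 0 (-α) τ) -
        corr C (-(K : ℤ)) ((Int.fract α : ℝ) : ℂ) μ τ =
      (-Complex.I * τ) ^ (-(K : ℤ) - 1) *
        (dInt α * riemannZeta ((-(K : ℤ) : ℤ) : ℂ) + Scal ((-(K : ℤ) : ℤ) : ℂ) α 0 μ 0 (1 / τ) +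
          (-1 : ℂ) ^ (-(K : ℤ) - 1) * Scal ((-(K : ℤ) : ℤ) : ℂ) (-α) 0 (-μ) 0 (1 / τ)) := by
  have h0 : τ ≠ 0 := by rintro rfl; simp at hτ
  have hs : I / τ ≠ 0 := div_ne_zero I_ne_zero h0
  have hneg := tendsto_mul_punctured (s := -1) (by norm_num)
  set L : ℕ → ℂ := fun K => ee ((α * μ : ℝ) : ℂ) *
          (psiIntC C (-(K : ℤ)) (-μ) α + Scal ((-(K : ℤ) : ℤ) : ℂ) 0 (-μ) 0 α τ +
            (-1 : ℂ) ^ (-(K : ℤ) - 1) * Scal ((-(K : ℤ) : ℤ) : ℂ) 0 μ 0 (-α) τ) -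
        corr C (-(K : ℤ)) ((Int.fract α : ℝ) : ℂ) μ τ with hL
  set R : ℕ → ℂ := fun K => (-Complex.I * τ) ^ (-(K : ℤ) - 1) *
        (dInt α * riemannZeta ((-(K : ℤ) : ℤ) : ℂ) + Scal ((-(K : ℤ) : ℤ) : ℂ) α 0 μ 0 (1 / τ) +
          (-1 : ℂ) ^ (-(K : ℤ) - 1) * Scal ((-(K : ℤ) : ℤ) : ℂ) (-α) 0 (-μ) 0 (1 / τ)) with hR
  set V : ℂ → ℂ := fun W => ee (Int.fract α * μ) * (I / τ * geoBilateral (ee (μ : ℂ)) 1 1 (I / τ)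
    (I / τ * (Int.fract α + W / (2 * π * I)))) + dInt α / W with hV
  have hLs : PunctHasSum (PowerSeries.mk fun K => L K / (Nat.factorial K : ℂ)) V := by
    filter_upwards [hasSum_psi_neg hC α μ,
      hasSum_ee_mul_Scal_neg hτ (β := Int.fract α) μ ⟨⌊α⌋, (Int.fract_add_floor α).symm⟩,
      hneg.eventually (hasSum_ee_mul_Scal_neg hτ (α := -α) (β := -Int.fract α) (-μ)
        ⟨-⌊α⌋, by rw [Int.fract]; push_cast; ring⟩),
      eventually_kronDiff_eq_zero hτ α μ] with W h1 h2 h3 h4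
    have h5 := hasSum_corr hC h0 ((Int.fract α : ℝ) : ℂ) μ W
    have h6 := ((h1.add h2).sub h3).sub h5
    rw [kronDiff, geoBilateral, inv_one] at h4
    have hval : V W = ee (Int.fract α * μ) * geoTerm (fracP (-μ)) (Int.fract α + W / (2 * π * I)) +
          dInt α / W +
        ee (Int.fract α * μ) * geoSeries 1 (fracP (-μ)) (I * τ) (Int.fract α + W / (2 * π * I)) -
        ee (((-Int.fract α : ℝ) : ℂ) * ((-μ : ℝ) : ℂ)) * geoSeries 1 (fracP (- -μ)) (I * τ)
          (((-Int.fract α : ℝ) : ℂ) + -1 * W / (2 * π * I)) -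
        -(ee (Int.fract α * μ) * (dInt μ / 2 + I / τ * (if ee (μ : ℂ) = 1 then
          Int.fract α + W / (2 * π * I) - 1 / 2 else 1 / (ee (μ : ℂ) - 1)))) := by
      rw [neg_neg, Complex.ofReal_neg, Complex.ofReal_neg, neg_mul_neg,
        show -((Int.fract α : ℝ) : ℂ) + -1 * W / (2 * π * I) =
          -(((Int.fract α : ℝ) : ℂ) + W / (2 * π * I)) by ring,
        hV]
      linear_combination -ee (Int.fract α * μ) * h4
    rw [hval]
    refine h6.congr_fun fun K => ?_
    rw [PowerSeries.coeff_mk, hL]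
    simp only [neg_one_zpow_neg_sub_one]
    rw [mul_pow, Complex.ofReal_neg, Complex.ofReal_neg, neg_mul_neg, neg_neg]
    push_cast
    ring
  have hRs : PunctHasSum (PowerSeries.mk fun K => R K / (Nat.factorial K : ℂ)) V := by
    filter_upwards [(tendsto_mul_punctured hs).eventually (hasSum_zeta_neg hC),
      hasSum_dual_Scal_neg hτ α μ, hneg.eventually (hasSum_dual_Scal_neg hτ (-α) (-μ)),
      im_mul_fract_add hτ α] with W h1 h2 h3 h4
    have h6 := ((((h1.mul_left (dInt α)).add h2).sub h3).mul_left (I / τ))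
    have h7 := dual_tsum_pos hτ α μ h4
    have h8 := dual_tsum_neg (τ := τ) α μ W
    have hval : V W = I / τ * (dInt α * (geoTerm 1 (I / τ * W / (2 * π * I)) + 1 / (I / τ * W)) +
        ∑' i : ℕ, ee ((fracP α + i) * μ) *
          geoTerm 1 (I / τ * (W / (2 * π * I) + fracP α + i)) -
        ∑' i : ℕ, ee ((fracP (-α) + i) * (-μ : ℝ)) *
          geoTerm 1 (I / τ * (-1 * W / (2 * π * I) + fracP (-α) + i))) := by
      rw [neg_one_mul, h8, mul_add (dInt α), add_right_comm, mul_div_assoc, h7, hV]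
      have h9 : I / τ * (dInt α * (1 / (I / τ * W))) = dInt α / W := by
        rw [mul_left_comm, one_div, mul_inv, mul_inv_cancel_left₀ hs, div_eq_mul_inv]
      simp only [geoBilateral]
      linear_combination -h9
    rw [hval]
    refine h6.congr_fun fun K => ?_
    have hI : (-I * τ) ^ (-(K : ℤ) - 1) = (I / τ) ^ (K + 1) := by
      rw [show (-(K : ℤ) - 1) = -((K + 1 : ℕ) : ℤ) by push_cast; ring, zpow_neg, zpow_natCast,
        ← inv_pow]
      congr 1
      rw [mul_inv, inv_neg, inv_I, neg_neg, div_eq_mul_inv]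
    rw [PowerSeries.coeff_mk, hR]
    simp only [neg_one_zpow_neg_sub_one, hI]
    rw [mul_pow, mul_pow, mul_pow, pow_succ]
    ring
  have h := congrArg (PowerSeries.coeff K) (hLs.unique hRs)
  rw [PowerSeries.coeff_mk, PowerSeries.coeff_mk] at h
  have hf : (Nat.factorial K : ℂ) ≠ 0 := by exact_mod_cast Nat.factorial_ne_zero K
  exact (div_left_inj' hf).mp h

end gen

/-- For `k ≥ 0` the series `𝒮_k` can be summed over its first index. -/
lemma hasSum_Scal_geoTerm (k : ℕ) (γ δ' κ lam : ℝ) {t : ℂ} (ht : 0 < t.re) :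
    HasSum (fun j : ℕ => ee (((fracP δ' + j) * lam : ℝ) : ℂ) *
        ((fracP δ' + j : ℝ) : ℂ) ^ (-(k : ℤ)) *
        geoTerm (fracP γ) (κ + I * t * ((fracP δ' + j : ℝ) : ℂ)))
      (Scal (((k : ℤ)) : ℂ) γ δ' κ lam t) := by
  have hpi := Real.pi_pos
  have hb := fracP_pos δ'
  have hg := fracP_pos γ
  have hbpos : ∀ j : ℕ, 0 < fracP δ' + j := fun j => by positivity
  set c : ℕ × ℕ → ℂ := fun p => ee (((fracP γ + p.1) * κ + (fracP δ' + p.2) * lam : ℝ) : ℂ) *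
    ((fracP δ' + p.2 : ℝ) : ℂ) ^ (-(k : ℤ)) *
    Complex.exp (-2 * (π : ℂ) * t * ((fracP γ + p.1 : ℝ) : ℂ) * ((fracP δ' + p.2 : ℝ) : ℂ))
    with hc
  have hs : Summable c := by
    refine Summable.of_norm_bounded ((summable_exp_bilinear (a := fracP γ) hb (c := 2 * π * t.re)
      (ρ := 0) (by positivity) (by positivity)).mul_left (fracP δ' ^ (-(k : ℤ)))) fun p => ?_
    have h1 : Real.exp (-(2 * π * t.re) * (fracP γ + p.1) * (fracP δ' + p.2) +
        0 * (fracP δ' + p.2)) = ‖Complex.exp (-2 * (π : ℂ) * t * ((fracP γ + p.1 : ℝ) : ℂ) *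
          ((fracP δ' + p.2 : ℝ) : ℂ))‖ := by
      rw [Complex.norm_exp, mul_assoc (_ * _), ← Complex.ofReal_mul, Complex.re_mul_ofReal]
      congr 1
      simp
      ring
    rw [hc, norm_mul, norm_mul, norm_ee_ofReal, one_mul, h1, norm_zpow, Complex.norm_real,
      Real.norm_of_nonneg (hbpos _).le, zpow_neg, zpow_neg, zpow_natCast, zpow_natCast]
    gcongr
    simp
  have hsw : Summable fun p : ℕ × ℕ => c p.swap := (Equiv.prodComm ℕ ℕ).summable_iff.mpr hs
  have hval : Scal (((k : ℤ)) : ℂ) γ δ' κ lam t = ∑' p : ℕ × ℕ, c p.swap := by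
    rw [Scal_eq_tsum_nat]
    exact hs.tsum_prod.symm.trans ((Equiv.prodComm ℕ ℕ).tsum_eq c).symm
  rw [hval]
  refine hsw.hasSum.prod_fiberwise fun j => ?_
  have him : 0 < ((κ : ℂ) + I * t * ((fracP δ' + j : ℝ) : ℂ)).im := by
    rw [Complex.add_im, Complex.im_mul_ofReal]
    simpa using mul_pos ht (hbpos j)
  refine ((hasSum_geoTerm (b := fracP γ) him).mul_left (ee (((fracP δ' + j) * lam : ℝ) : ℂ) *
        ((fracP δ' + j : ℝ) : ℂ) ^ (-(k : ℤ)))).congr_fun fun i => ?_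
  rw [hc]
  simp only [Prod.swap_prod_mk]
  have h2 : Complex.exp (-2 * (π : ℂ) * t * ((fracP γ + i : ℝ) : ℂ) *
      ((fracP δ' + j : ℝ) : ℂ)) =
      ee (((fracP γ + i : ℝ) : ℂ) * (I * t * ((fracP δ' + j : ℝ) : ℂ))) := by
    rw [ee_eq_exp]; congr 1
    linear_combination (-2 * π * t * ((fracP γ + i : ℝ) : ℂ) * ((fracP δ' + j : ℝ) : ℂ)) * I_sq
  rw [h2, mul_right_comm, ← ee_add, mul_right_comm _ _ (ee _), ← ee_add]
  congr 2
  push_cast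
  ring

lemma hasDerivAt_ee_mul (c : ℂ) (x : ℝ) :
    HasDerivAt (fun X : ℝ => ee (c * X)) (2 * π * I * c * ee (c * x)) x := by
  have h1 : HasDerivAt (fun X : ℝ => 2 * (π : ℂ) * I * (c * X)) (2 * π * I * c) x := by
    simpa [mul_assoc] using ((hasDerivAt_id (x : ℂ)).comp_ofReal.const_mul (2 * (π : ℂ) * I * c))
  have := h1.cexp
  refine this.congr_deriv ?_
  rw [ee, mul_comm]

lemma continuous_ee_mul (c : ℂ) : Continuous fun X : ℝ => ee (c * X) := by
  unfold ee; fun_prop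

/-- The Fourier coefficients of `X ↦ e(Xw)/(1 - e(w))` on `[0,1]`. -/
lemma integral_geoTerm {w : ℂ} (hw : ee w ≠ 1) (l : ℤ) :
    ∫ X in (0 : ℝ)..1, ee (-(l * X)) * geoTerm X w = -1 / (2 * π * I * (w - l)) := by
  have hwl : w - l ≠ 0 := by
    intro h
    apply hw
    rw [sub_eq_zero.mp h, ee_intCast]
  have h1 : 1 - ee w ≠ 0 := sub_ne_zero.mpr hw.symm
  have hpi := Complex.two_pi_I_ne_zero
  have h2 : ∫ X in (0 : ℝ)..1, 2 * π * I * (w - l) * ee ((w - l) * X) = ee w - 1 := by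
    rw [intervalIntegral.integral_eq_sub_of_hasDerivAt (fun x _ => hasDerivAt_ee_mul (w - l) x)
      (((continuous_ee_mul _).const_mul _).intervalIntegrable _ _)]
    simp [ee_zero, ee_sub_intCast]
  rw [intervalIntegral.integral_const_mul] at h2
  have h3 : ∀ X : ℝ, ee (-(l * X)) * geoTerm X w = ee ((w - l) * X) * (1 - ee w)⁻¹ := by
    intro X
    rw [geoTerm, ← mul_div_assoc, ← ee_add, div_eq_mul_inv]
    congr 2; ring
  simp_rw [h3]
  rw [intervalIntegral.integral_mul_const, eq_div_iff (mul_ne_zero hpi hwl)]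
  field_simp
  linear_combination h2

/-- A continuous `1`-periodic function with summable Fourier coefficients is the sum of its Fourier
series. -/
lemma hasSum_fourier_of_integral {F : ℝ → ℂ} (hF : ContinuousOn F (Set.Icc 0 1)) (h01 : F 0 = F 1)
    {c : ℤ → ℂ} (hc : ∀ l : ℤ, ∫ X in (0 : ℝ)..1, ee (-(l * X)) * F X = c l) (hs : Summable c)
    {x : ℝ} (hx : x ∈ Set.Ico 0 1) : HasSum (fun l : ℤ => c l * ee (l * x)) (F x) := by
  have hcont : Continuous (AddCircle.liftIco (1 : ℝ) 0 F) :=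
    AddCircle.liftIco_zero_continuous h01 hF
  have hcoef : ∀ l, fourierCoeff (AddCircle.liftIco (1 : ℝ) 0 F) l = c l := by
    intro l
    rw [fourierCoeff_liftIco_eq, fourierCoeffOn_eq_integral, ← hc l]
    simp only [fourier_coe_apply, zero_add, sub_zero, div_one, one_smul, smul_eq_mul]
    refine intervalIntegral.integral_congr fun X _ => ?_
    simp only [ee_eq_exp]
    congr 2
    push_cast
    ring
  have h := has_pointwise_sum_fourier_series_of_summable
    (f := ⟨AddCircle.liftIco (1 : ℝ) 0 F, hcont⟩) (by
      refine hs.congr fun l => (hcoef l).symm) (x : AddCircle (1 : ℝ))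
  rw [ContinuousMap.coe_mk, AddCircle.liftIco_coe_apply (by simpa using hx)] at h
  refine h.congr_fun fun l => ?_
  rw [hcoef, smul_eq_mul, fourier_coe_apply, ee_eq_exp]
  congr 2
  push_cast
  ring

section gen

variable {C : ℕ → ℂ → ℝ → ℂ}
    (hC : ∀ (X : ℂ) (κ : ℝ), ∀ᶠ Z in nhdsWithin (0 : ℂ) {(0 : ℂ)}ᶜ,
      HasSum (fun j : ℕ => C j X κ * Z ^ j / (Nat.factorial j : ℂ))
        (Z * ee (X * (κ : ℂ)) * Complex.exp (X * Z) / (ee ((κ : ℝ) : ℂ) * Complex.exp Z - 1)))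

include hC

lemma C_div_factorial_eq (j : ℕ) (X : ℂ) (κ : ℝ) : C j X κ / (Nat.factorial j : ℂ) =
    ee (X * κ) * ∑ a ∈ Finset.range (j + 1), X ^ a / (Nat.factorial a : ℂ) *
      (C (j - a) 0 κ / (Nat.factorial (j - a) : ℂ)) := by
  have h := congrArg (PowerSeries.coeff j) (genC_eq hC X κ)
  rw [PowerSeries.coeff_C_mul, PowerSeries.coeff_mul,
    Finset.Nat.sum_antidiagonal_eq_sum_range_succ_mk] at h
  simp only [genC, PowerSeries.coeff_mk, PowerSeries.coeff_rescale, PowerSeries.coeff_exp] at h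
  rw [h]
  simp [div_eq_mul_inv]

lemma C_one_sub_C_zero (j : ℕ) (κ : ℝ) :
    C j 1 κ / (Nat.factorial j : ℂ) - C j 0 κ / (Nat.factorial j : ℂ) = if j = 1 then 1 else 0 := by
  have h := genC_zero_mul hC κ
  have h1 := genC_eq hC 1 κ
  rw [one_mul, PowerSeries.rescale_one, RingHom.id_apply] at h1
  have h2 : genC C 1 κ - genC C 0 κ = PowerSeries.X := by
    rw [← h, h1]; ring
  have h3 := congrArg (PowerSeries.coeff j) h2
  simpa [genC, PowerSeries.coeff_X] using h3

lemma continuous_C (j : ℕ) (κ : ℝ) : Continuous fun X : ℝ => C j X κ / (Nat.factorial j : ℂ) := by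
  simp_rw [C_div_factorial_eq hC j]
  refine Continuous.mul ?_ (by fun_prop)
  simpa [mul_comm] using continuous_ee_mul (κ : ℂ)

lemma hasDerivAt_C (j : ℕ) (κ : ℝ) (x : ℝ) :
    HasDerivAt (fun X : ℝ => C j X κ / (Nat.factorial j : ℂ))
      (2 * π * I * κ * (C j x κ / (Nat.factorial j : ℂ)) +
        if j = 0 then 0 else C (j - 1) x κ / (Nat.factorial (j - 1) : ℂ)) x := by
  have hfun : (fun X : ℝ => C j X κ / (Nat.factorial j : ℂ)) = fun X : ℝ => ee (κ * X) *
      ∑ a ∈ Finset.range (j + 1), (X : ℂ) ^ a / (Nat.factorial a : ℂ) *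
        (C (j - a) 0 κ / (Nat.factorial (j - a) : ℂ)) := funext fun X => by
    rw [C_div_factorial_eq hC j X κ, mul_comm (X : ℂ)]
  rw [hfun, C_div_factorial_eq hC j x κ]
  have h1 := hasDerivAt_ee_mul κ x
  have h2 : HasDerivAt (fun X : ℝ => ∑ a ∈ Finset.range (j + 1), (X : ℂ) ^ a /
      (Nat.factorial a : ℂ) * (C (j - a) 0 κ / (Nat.factorial (j - a) : ℂ)))
      (∑ a ∈ Finset.range (j + 1), (a * (x : ℂ) ^ (a - 1)) /
      (Nat.factorial a : ℂ) * (C (j - a) 0 κ / (Nat.factorial (j - a) : ℂ))) x := by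
    refine HasDerivAt.fun_sum fun a _ => ?_
    exact (((hasDerivAt_pow a (x : ℂ)).comp_ofReal).div_const _).mul_const _
  have h3 := h1.mul h2
  refine h3.congr_deriv ?_
  rw [mul_comm (x : ℂ), mul_assoc]
  congr 1
  rcases j with _ | j
  · simp
  · rw [if_neg (by omega), Nat.add_sub_cancel, C_div_factorial_eq hC j x κ,
      Finset.sum_range_succ', mul_comm (x : ℂ)]
    simp only [Nat.cast_zero, zero_mul, zero_div, add_zero, Nat.add_sub_cancel]
    congr 1
    refine Finset.sum_congr rfl fun a _ => ?_
    rw [Nat.factorial_succ, Nat.add_sub_add_right]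
    have ha : (a : ℂ) + 1 ≠ 0 := by exact_mod_cast Nat.succ_ne_zero a
    congr 1
    push_cast
    field_simp

lemma integral_C_rec (j : ℕ) (κ : ℝ) (l : ℤ) :
    (2 * π * I * (κ - l)) * (∫ X in (0 : ℝ)..1, ee (-(l * X)) * (C j X κ / (Nat.factorial j : ℂ))) +
      (if j = 0 then 0 else
        ∫ X in (0 : ℝ)..1, ee (-(l * X)) * (C (j - 1) X κ / (Nat.factorial (j - 1) : ℂ))) =
      if j = 1 then 1 else 0 := by
  have he : Continuous fun X : ℝ => ee (-(l * X)) := by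
    simpa [neg_mul] using continuous_ee_mul (-l : ℂ)
  have hd : ∀ x : ℝ, HasDerivAt (fun X : ℝ => ee (-(l * X)) * (C j X κ / (Nat.factorial j : ℂ)))
      ((2 * π * I * (κ - l)) * (ee (-(l * x)) * (C j x κ / (Nat.factorial j : ℂ))) +
        (if j = 0 then 0 else ee (-(l * x)) * (C (j - 1) x κ / (Nat.factorial (j - 1) : ℂ)))) x := by
    intro x
    have h1 := (hasDerivAt_ee_mul (-l : ℂ) x).mul (hasDerivAt_C hC j κ x)
    simp only [neg_mul] at h1
    refine h1.congr_deriv ?_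
    split_ifs <;> ring
  have hc1 : Continuous fun x : ℝ => (2 * π * I * (κ - l)) *
      (ee (-(l * x)) * (C j x κ / (Nat.factorial j : ℂ))) :=
    (he.mul (continuous_C hC j κ)).const_mul (2 * π * I * (κ - l))
  have hc2 : Continuous fun x : ℝ => if j = 0 then 0 else
      ee (-(l * x)) * (C (j - 1) x κ / (Nat.factorial (j - 1) : ℂ)) := by
    split_ifs
    · exact continuous_const
    · exact he.mul (continuous_C hC (j - 1) κ)
  have h := intervalIntegral.integral_eq_sub_of_hasDerivAt (a := 0) (b := 1) (fun x _ => hd x)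
    ((hc1.add hc2).intervalIntegrable _ _)
  rw [intervalIntegral.integral_add (hc1.intervalIntegrable _ _) (hc2.intervalIntegrable _ _),
    intervalIntegral.integral_const_mul] at h
  have hl : ee (-(l : ℂ)) = 1 := by simpa using ee_intCast (-l)
  simp only [Complex.ofReal_one, Complex.ofReal_zero, mul_one, mul_zero, neg_zero, ee_zero, hl,
    one_mul, C_one_sub_C_zero hC] at h
  rw [← h]
  split_ifs
  · simp
  · rfl

lemma integral_C_of_ne {κ : ℝ} {l : ℤ} (h : (l : ℂ) - κ ≠ 0) (j : ℕ) :
    ∫ X in (0 : ℝ)..1, ee (-(l * X)) * (C j X κ / (Nat.factorial j : ℂ)) =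
      if j = 0 then 0 else -(2 * π * I * (l - κ))⁻¹ ^ j := by
  have hx := mul_ne_zero Complex.two_pi_I_ne_zero h
  induction j with
  | zero =>
    have := integral_C_rec hC 0 κ l
    rw [if_pos rfl, add_zero, if_neg (by omega)] at this
    rw [if_pos rfl]
    refine (mul_eq_zero.mp this).resolve_left ?_
    intro h0
    apply hx
    linear_combination -h0
  | succ j ih =>
    have := integral_C_rec hC (j + 1) κ l
    rw [if_neg (by omega), Nat.add_sub_cancel, ih] at this
    rw [if_neg (by omega)]
    have key : ∀ y : ℂ, ((2 * π * I * (κ - l)) * y + if j = 0 then 0 else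
        -(2 * π * I * (l - κ))⁻¹ ^ j) = (if j + 1 = 1 then 1 else 0) →
        y = -(2 * π * I * (l - κ))⁻¹ ^ (j + 1) := by
      intro y hy
      rcases j with _ | j
      · simp only [if_true, zero_add] at hy
        rw [zero_add, pow_one]
        refine mul_left_cancel₀ hx ?_
        rw [mul_neg, mul_inv_cancel₀ hx]
        linear_combination -hy
      · rw [if_neg (by omega), if_neg (by omega)] at hy
        refine mul_left_cancel₀ hx ?_
        rw [pow_succ _ (j + 1), mul_neg, mul_comm (_ ^ (j + 1)), mul_inv_cancel_left₀ hx]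
        linear_combination -hy
    exact key _ this

lemma integral_C_of_eq {κ : ℝ} {l : ℤ} (h : (l : ℂ) - κ = 0) (j : ℕ) :
    ∫ X in (0 : ℝ)..1, ee (-(l * X)) * (C j X κ / (Nat.factorial j : ℂ)) =
      if j = 0 then 1 else 0 := by
  have := integral_C_rec hC (j + 1) κ l
  rw [if_neg (by omega), Nat.add_sub_cancel, ← neg_sub (l : ℂ) κ, h] at this
  simpa using this

end gen

lemma neg_one_pow_mul_bernoulli {k : ℕ} (hk : k ≠ 1) :
    (-1 : ℂ) ^ k * ((bernoulli k : ℚ) : ℂ) = ((bernoulli k : ℚ) : ℂ) := by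
  rcases Nat.even_or_odd k with h | h
  · rw [h.neg_one_pow, one_mul]
  · have : bernoulli k = 0 := bernoulli_eq_zero_of_odd h (by rcases h with ⟨m, rfl⟩; omega)
    simp [this]

lemma hasSum_inv_pow_add_neg_one_pow {k : ℕ} (hk : 2 ≤ k) :
    HasSum (fun n : ℕ => (1 + (-1 : ℂ) ^ k) * (((n : ℂ) + 1) ^ k)⁻¹)
      (-(-(2 * π * I)) ^ k * (((bernoulli k : ℚ) : ℂ) / (Nat.factorial k : ℂ))) := by
  have h := hasSum_one_div_nat_pow_mul_fourier hk (x := 0) (by simp)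
  have h2 := (hasSum_nat_add_iff' 1).mpr h
  have hk0 : k ≠ 0 := by omega
  have hval : -(-(2 * π * I)) ^ k * (((bernoulli k : ℚ) : ℂ) / (Nat.factorial k : ℂ)) =
      -(2 * π * I) ^ k / (Nat.factorial k : ℂ) * (bernoulliFun k 0 : ℝ) -
      ∑ i ∈ Finset.range 1, 1 / ((i : ℕ) : ℂ) ^ k * (fourier (i : ℤ) ((0 : ℝ) : UnitAddCircle) +
        (-1) ^ k * fourier (-(i : ℤ)) ((0 : ℝ) : UnitAddCircle)) := by
    rw [bernoulliFun_eval_zero, Finset.sum_range_one, Nat.cast_zero, zero_pow hk0, div_zero,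
      zero_mul, sub_zero, neg_pow (2 * π * I)]
    have := neg_one_pow_mul_bernoulli (k := k) (by omega)
    push_cast
    linear_combination -(2 * π * I) ^ k / (Nat.factorial k : ℂ) * this
  rw [hval]
  refine h2.congr_fun fun n => ?_
  rw [fourier_coe_apply, fourier_coe_apply]
  simp
  ring

/-- The `n`-th term of the Mittag-Leffler type expansion of `ζ`-weighted cotangent. -/
def cotTermPow (k : ℕ) (u : ℂ) (n : ℕ) : ℂ :=
  (((n : ℂ) + 1) ^ k)⁻¹ * (1 / (((n : ℂ) + 1) + u) - (-1) ^ k / (((n : ℂ) + 1) - u))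

/-- The sum of `cotTermPow` up to a power of `-2πi`, in terms of `β = 2πiu`. -/
def cotValPow (k : ℕ) (β : ℂ) : ℂ :=
  (β ^ k)⁻¹ / (1 - Complex.exp β) + ∑ j ∈ Finset.range (k + 1),
    (β ^ (j + 1))⁻¹ * (((bernoulli (k - j) : ℚ) : ℂ) / (Nat.factorial (k - j) : ℂ))

lemma cotValPow_succ (k : ℕ) {β : ℂ} : cotValPow (k + 1) β =
    (cotValPow k β + ((bernoulli (k + 1) : ℚ) : ℂ) / (Nat.factorial (k + 1) : ℂ)) / β := by
  rw [cotValPow, Finset.sum_range_succ', cotValPow, add_div, add_div, Finset.sum_div]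
  simp only [Nat.add_sub_add_right, Nat.sub_zero, zero_add, pow_one]
  have h : ∀ m, (β ^ (m + 1))⁻¹ = (β ^ m)⁻¹ / β := fun m => by
    rw [pow_succ, mul_inv, div_eq_mul_inv]
  have h2 : ∀ x ∈ Finset.range (k + 1), (β ^ (x + 1 + 1))⁻¹ *
      (((bernoulli (k - x) : ℚ) : ℂ) / (Nat.factorial (k - x) : ℂ)) = (β ^ (x + 1))⁻¹ *
      (((bernoulli (k - x) : ℚ) : ℂ) / (Nat.factorial (k - x) : ℂ)) / β := fun x _ => by
    rw [h (x + 1)]; ring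
  rw [Finset.sum_congr rfl h2, h k]
  ring

lemma hasSum_cotTermPow {u : ℂ} (hu : u ∈ Complex.integerComplement) (k : ℕ) :
    HasSum (cotTermPow (k + 1) u)
      ((-(2 * π * I)) ^ (k + 2) * cotValPow (k + 1) (2 * π * I * u)) := by
  have hu0 : u ≠ 0 := by
    rintro rfl
    exact hu ⟨0, by simp⟩
  have hpI := Complex.two_pi_I_ne_zero
  have hm1 : ∀ n : ℕ, (n : ℂ) + 1 ≠ 0 := fun n => by exact_mod_cast Nat.succ_ne_zero n
  have hm2 : ∀ n : ℕ, ((n : ℂ) + 1) + u ≠ 0 := fun n h => hu ⟨-((n : ℤ) + 1), by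
    push_cast; linear_combination -h⟩
  have hm3 : ∀ n : ℕ, ((n : ℂ) + 1) - u ≠ 0 := fun n h => hu ⟨(n : ℤ) + 1, by
    push_cast; linear_combination h⟩
  have hrec : ∀ k n, cotTermPow (k + 1) u n =
      ((1 + (-1 : ℂ) ^ (k + 1)) * (((n : ℂ) + 1) ^ (k + 1))⁻¹ - cotTermPow k u n) / u := by
    intro k n
    have := hm1 n
    have := hm2 n
    have := hm3 n
    rw [cotTermPow, cotTermPow, eq_div_iff hu0, pow_succ (-1 : ℂ)]
    field_simp
    ring
  induction k with
  | zero =>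
    have h := (summable_cotTerm hu).hasSum
    rw [← cot_series_rep' hu, cot_pi_eq_exp_ratio] at h
    have he : 1 - Complex.exp (2 * π * I * u) ≠ 0 := by
      intro h0
      obtain ⟨n, hn⟩ := Complex.exp_eq_one_iff.mp (sub_eq_zero.mp h0).symm
      refine hu ⟨n, mul_left_cancel₀ hpI ?_⟩
      rw [hn, mul_comm]
    have hval : (-(2 * π * I)) ^ (0 + 2) * cotValPow (0 + 1) (2 * π * I * u) =
        -(π * ((Complex.exp (2 * π * I * u) + 1) / (I * (1 - Complex.exp (2 * π * I * u)))) -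
          1 / u) / u := by
      rw [cotValPow_succ, cotValPow]
      simp only [zero_add, bernoulli_one, pow_zero, inv_one, Finset.sum_range_one, pow_one,
        Nat.sub_self, bernoulli_zero, Nat.factorial_zero, Nat.factorial_one]
      push_cast
      have hI := Complex.I_ne_zero
      have hp : (π : ℂ) ≠ 0 := by exact_mod_cast Real.pi_ne_zero
      rw [show (π : ℂ) * ((Complex.exp (2 * π * I * u) + 1) /
        (I * (1 - Complex.exp (2 * π * I * u)))) = -I * π * ((Complex.exp (2 * π * I * u) + 1) /
        (1 - Complex.exp (2 * π * I * u))) by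
          rw [mul_comm I, ← div_div, div_eq_mul_inv _ I, Complex.inv_I]; ring]
      field_simp
      ring
    rw [hval]
    refine (h.neg.div_const u).congr_fun fun n => ?_
    rw [hrec, cotTermPow]
    have := hm2 n
    have := hm3 n
    have h4 : u - (n + 1) ≠ 0 := fun h => hm3 n (by linear_combination -h)
    have h5 : u + (n + 1) ≠ 0 := fun h => hm2 n (by linear_combination h)
    field_simp
    ring
  | succ k ih =>
    have h := ((hasSum_inv_pow_add_neg_one_pow (k := k + 2) (by omega)).sub ih).div_const u
    have hval : (-(2 * π * I)) ^ (k + 1 + 2) * cotValPow (k + 1 + 1) (2 * π * I * u) =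
        (-(-(2 * π * I)) ^ (k + 2) *
          (((bernoulli (k + 2) : ℚ) : ℂ) / (Nat.factorial (k + 2) : ℂ)) -
        (-(2 * π * I)) ^ (k + 2) * cotValPow (k + 1) (2 * π * I * u)) / u := by
      rw [cotValPow_succ (k + 1)]
      field_simp
      ring
    rw [hval]
    exact h.congr_fun fun n => hrec (k + 1) n

lemma norm_geoTerm_le_of_mem_Icc {X : ℝ} (hX : X ∈ Set.Icc (0 : ℝ) 1) {w : ℂ} {y : ℝ} (hy : 0 < y)
    (hw : y ≤ |w.im|) : ‖geoTerm X w‖ ≤ (1 - Real.exp (-2 * π * y))⁻¹ := by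
  have hpi := Real.pi_pos
  have hbound : ∀ {P : ℝ} {w : ℂ}, 0 ≤ P → y ≤ w.im →
      ‖geoTerm P w‖ ≤ (1 - Real.exp (-2 * π * y))⁻¹ := by
    intro P w hP hw
    refine (norm_geoTerm_le hP hy hw).trans ?_
    have h1 : Real.exp (-2 * π * y) < 1 := by
      rw [Real.exp_lt_one_iff]; nlinarith [mul_pos hpi hy]
    rw [div_eq_mul_inv]
    refine mul_le_of_le_one_left (inv_nonneg.mpr (by linarith)) ?_
    rw [Real.exp_le_one_iff]
    nlinarith [mul_nonneg (mul_nonneg hpi.le hP) hy.le]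
  rcases le_abs.mp hw with h | h
  · exact hbound hX.1 h
  · rw [eq_neg_of_add_eq_zero_left (geoTerm_add_geoTerm_neg_of_add_eq_one
      (show X + (1 - X) = 1 by ring) w), norm_neg]
    exact hbound (by linarith [hX.2]) (by simpa using h)

lemma geoTerm_one_sub_geoTerm_zero {w : ℂ} (hw : 1 - ee w ≠ 0) :
    geoTerm 1 w - geoTerm 0 w = -1 := by
  simp only [geoTerm, Complex.ofReal_one, one_mul, Complex.ofReal_zero, zero_mul, ee_zero]
  field_simp
  ring

lemma continuous_geoTerm (w : ℂ) : Continuous fun X : ℝ => geoTerm X w := by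
  unfold geoTerm
  simpa [mul_comm] using (continuous_ee_mul w).div_const (1 - ee w)

/-- The pair of terms indexed by `±(n+1)` of a bilateral weighted Kronecker series. -/
def geoPair (k : ℕ) (σ : ℂ) (μ : ℝ) (n : ℕ) (X : ℝ) : ℂ :=
  (((n : ℂ) + 1) ^ k)⁻¹ *
    (geoTerm X (μ + σ * (n + 1)) + (-1) ^ k * geoTerm X (μ - σ * (n + 1)))

section geoPair

variable {k : ℕ} {σ : ℂ} (hσ : 0 < σ.im) (μ : ℝ)

lemma le_im_add (n : ℕ) : ((μ : ℂ) + σ * (n + 1)).im = σ.im * (n + 1) := by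
  rw [Complex.add_im, Complex.ofReal_im, zero_add, show (n : ℂ) + 1 = ((n + 1 : ℝ) : ℂ) by simp,
    Complex.im_mul_ofReal]

lemma le_im_sub (n : ℕ) : ((μ : ℂ) - σ * (n + 1)).im = -(σ.im * (n + 1)) := by
  rw [Complex.sub_im, Complex.ofReal_im, zero_sub, show (n : ℂ) + 1 = ((n + 1 : ℝ) : ℂ) by simp,
    Complex.im_mul_ofReal]

lemma continuous_geoPair (n : ℕ) : Continuous (geoPair k σ μ n) :=
  ((continuous_geoTerm _).add ((continuous_geoTerm _).const_mul _)).const_mul _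

lemma summable_geoPair_bound (hk : 2 ≤ k) (M : ℝ) :
    Summable fun n : ℕ => (((n : ℝ) + 1) ^ k)⁻¹ * M := by
  refine Summable.mul_right _ ?_
  have := (summable_nat_add_iff 1).mpr (Real.summable_nat_pow_inv.mpr (show 1 < k by omega))
  simpa using this

include hσ

lemma one_sub_ee_add_ne_zero (n : ℕ) : 1 - ee (μ + σ * (n + 1)) ≠ 0 := by
  refine one_sub_ee_ne_zero_of_im_ne_zero ?_
  rw [le_im_add]; positivity

lemma one_sub_ee_sub_ne_zero (n : ℕ) : 1 - ee (μ - σ * (n + 1)) ≠ 0 := by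
  refine one_sub_ee_ne_zero_of_im_ne_zero ?_
  rw [le_im_sub, neg_ne_zero]; positivity

lemma norm_geoPair_le (n : ℕ) {X : ℝ} (hX : X ∈ Set.Icc (0 : ℝ) 1) : ‖geoPair k σ μ n X‖ ≤
    (((n : ℝ) + 1) ^ k)⁻¹ * (2 * (1 - Real.exp (-2 * π * σ.im))⁻¹) := by
  have hle : σ.im ≤ σ.im * (n + 1) := le_mul_of_one_le_right hσ.le (by simp)
  have h0 : 0 < σ.im * (n + 1) := by positivity
  have h1 := norm_geoTerm_le_of_mem_Icc hX (w := μ + σ * (n + 1)) hσ (by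
    rw [le_im_add, abs_of_pos h0]; exact hle)
  have h2 := norm_geoTerm_le_of_mem_Icc hX (w := μ - σ * (n + 1)) hσ (by
    rw [le_im_sub, abs_neg, abs_of_pos h0]; exact hle)
  have h3 : ‖((n : ℂ) + 1)‖ = (n : ℝ) + 1 := by
    rw [← Nat.cast_succ, Complex.norm_natCast]; simp
  rw [geoPair, norm_mul, norm_inv, norm_pow, h3]
  gcongr
  refine (norm_add_le _ _).trans ?_
  rw [norm_mul, norm_pow, norm_neg, norm_one, one_pow, one_mul]
  linarith

lemma hasSum_integral_geoPair (hk : 2 ≤ k) (l : ℤ) :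
    HasSum (fun n => ∫ X in (0 : ℝ)..1, ee (-(l * X)) * geoPair k σ μ n X)
      (∫ X in (0 : ℝ)..1, ee (-(l * X)) * ∑' n, geoPair k σ μ n X) := by
  have he : Continuous fun X : ℝ => ee (-(l * X)) := by
    simpa [neg_mul] using continuous_ee_mul (-l : ℂ)
  have hmem : ∀ X ∈ Set.uIoc (0 : ℝ) 1, X ∈ Set.Icc (0 : ℝ) 1 := fun X hX => by
    rw [Set.uIoc_of_le zero_le_one] at hX; exact Set.Ioc_subset_Icc_self hX
  have hs := summable_geoPair_bound hk (2 * (1 - Real.exp (-2 * π * σ.im))⁻¹)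
  refine intervalIntegral.hasSum_integral_of_dominated_convergence
    (fun n _ => (((n : ℝ) + 1) ^ k)⁻¹ * (2 * (1 - Real.exp (-2 * π * σ.im))⁻¹))
    (fun n => (he.mul (continuous_geoPair μ n)).aestronglyMeasurable) (fun n => ?_) ?_ ?_ ?_
  · refine ae_of_all _ fun X hX => ?_
    have h1 : ‖ee (-(l * X))‖ = 1 := by
      rw [show -((l : ℂ) * X) = ((-(l * X) : ℝ) : ℂ) by push_cast; ring, norm_ee_ofReal]
    rw [norm_mul, h1, one_mul]
    exact norm_geoPair_le hσ μ n (hmem X hX)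
  · exact ae_of_all _ fun X hX => hs
  · exact intervalIntegrable_const
  · refine ae_of_all _ fun X hX => HasSum.mul_left _ ?_
    exact (Summable.of_norm_bounded hs fun n => norm_geoPair_le hσ μ n (hmem X hX)).hasSum

lemma summable_geoPair (hk : 2 ≤ k) {X : ℝ} (hX : X ∈ Set.Icc (0 : ℝ) 1) :
    Summable fun n => geoPair k σ μ n X :=
  Summable.of_norm_bounded (summable_geoPair_bound hk _) fun n => norm_geoPair_le hσ μ n hX

lemma continuousOn_tsum_geoPair (hk : 2 ≤ k) :
    ContinuousOn (fun X => ∑' n, geoPair k σ μ n X) (Set.Icc 0 1) :=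
  continuousOn_tsum (fun n => (continuous_geoPair μ n).continuousOn)
    (summable_geoPair_bound hk _) fun n _ hX => norm_geoPair_le hσ μ n hX

lemma tsum_geoPair_one_sub_zero (hk : 2 ≤ k) :
    (∑' n, geoPair k σ μ n 1) - ∑' n, geoPair k σ μ n 0 =
      (-(2 * π * I)) ^ k * (((bernoulli k : ℚ) : ℂ) / (Nat.factorial k : ℂ)) := by
  have h0 := (summable_geoPair hσ μ hk (X := 0) (by simp)).hasSum
  have h1 := (summable_geoPair hσ μ hk (X := 1) (by simp)).hasSum
  have h2 := (hasSum_inv_pow_add_neg_one_pow hk).neg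
  rw [neg_mul, neg_neg] at h2
  refine (h1.sub h0).unique (h2.congr_fun fun n => ?_)
  have h3 := geoTerm_one_sub_geoTerm_zero (one_sub_ee_add_ne_zero hσ μ n)
  have h4 := geoTerm_one_sub_geoTerm_zero (one_sub_ee_sub_ne_zero hσ μ n)
  rw [geoPair, geoPair]
  linear_combination (((n : ℂ) + 1) ^ k)⁻¹ * (h3 + (-1) ^ k * h4)

end geoPair

lemma integral_geoPair {k : ℕ} {τ : ℂ} (hτ : 0 < τ.re) (μ : ℝ) (l : ℤ) (n : ℕ) :
    ∫ X in (0 : ℝ)..1, ee (-(l * X)) * geoPair k (I / τ) μ n X =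
      τ / (2 * π) * cotTermPow k (I * τ * (l - μ)) n := by
  have h0 : τ ≠ 0 := by rintro rfl; simp at hτ
  have hσ := im_I_div_pos hτ
  have he : Continuous fun X : ℝ => ee (-(l * X)) := by
    simpa [neg_mul] using continuous_ee_mul (-l : ℂ)
  have hi : ∀ w, IntervalIntegrable (fun X : ℝ => ee (-(l * X)) * geoTerm X w) volume 0 1 :=
    fun w => (he.mul (continuous_geoTerm w)).intervalIntegrable _ _
  have h1 := integral_geoTerm (sub_ne_zero.mp (one_sub_ee_add_ne_zero hσ μ n)).symm l
  have h2 := integral_geoTerm (sub_ne_zero.mp (one_sub_ee_sub_ne_zero hσ μ n)).symm l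
  have h3 : ∀ X : ℝ, ee (-(l * X)) * geoPair k (I / τ) μ n X = (((n : ℂ) + 1) ^ k)⁻¹ *
      (ee (-(l * X)) * geoTerm X (μ + I / τ * (n + 1)) +
        (-1) ^ k * (ee (-(l * X)) * geoTerm X (μ - I / τ * (n + 1)))) := by
    intro X; rw [geoPair]; ring
  simp_rw [h3]
  rw [intervalIntegral.integral_const_mul, intervalIntegral.integral_add (hi _)
    ((hi _).const_mul _), intervalIntegral.integral_const_mul, h1, h2, cotTermPow]
  have hpi : (π : ℂ) ≠ 0 := by exact_mod_cast Real.pi_ne_zero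
  have e1 : (μ : ℂ) + I / τ * (n + 1) - l = I / τ * ((n + 1) + I * τ * (l - μ)) := by
    field_simp; linear_combination (-τ * (l - μ)) * I_sq
  have e2 : (μ : ℂ) - I / τ * (n + 1) - l = -(I / τ) * ((n + 1) - I * τ * (l - μ)) := by
    field_simp; linear_combination (-τ * (l - μ)) * I_sq
  rw [e1, e2]
  have e3 : ∀ y : ℂ, -1 / (2 * π * I * (I / τ * y)) = τ / (2 * π) * (1 / y) := by
    intro y
    rw [show 2 * π * I * (I / τ * y) = -(2 * π / τ * y) by linear_combination 2 * π / τ * y * I_sq]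
    rw [neg_div_neg_eq, one_div, mul_inv, inv_div, one_div]
  have e4 : ∀ y : ℂ, -1 / (2 * π * I * (-(I / τ) * y)) = -(τ / (2 * π) * (1 / y)) := by
    intro y
    rw [← e3, neg_mul, mul_neg, div_neg]
  rw [e3, e4]
  ring

lemma corr_natCast (C : ℕ → ℂ → ℝ → ℂ) (k : ℕ) (X : ℂ) (μ : ℝ) (τ : ℂ) :
    corr C (k : ℤ) X μ τ = ∑ j ∈ Finset.range (k + 2), ((-2 * (π : ℂ)) ^ k * (-I) ^ j *
      (((bernoulli (k + 1 - j) : ℚ) : ℂ) / (Nat.factorial (k + 1 - j) : ℂ)) *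
        τ ^ ((k : ℤ) - (j : ℤ))) * (C j X μ / (Nat.factorial j : ℂ)) := by
  rw [corr, zpow_natCast, Finset.mul_sum, show ((k : ℤ) + 2).toNat = k + 2 by omega,
    show ((k : ℤ) + 1).toNat = k + 1 by omega]
  refine Finset.sum_congr rfl fun j _ => ?_
  rw [mul_div_mul_comm]
  ring

/-- The function of `X` whose Fourier series on `[0,1)` gives the pairing of `ψ(k)` and `ζ(k)`. -/
def pairFun (C : ℕ → ℂ → ℝ → ℂ) (k : ℕ) (μ : ℝ) (τ : ℂ) (X : ℝ) : ℂ :=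
  corr C (k : ℤ) X μ τ + (-I * τ) ^ ((k : ℤ) - 1) * ∑' n, geoPair k (I / τ) μ n X

section gen

variable {C : ℕ → ℂ → ℝ → ℂ}
    (hC : ∀ (X : ℂ) (κ : ℝ), ∀ᶠ Z in nhdsWithin (0 : ℂ) {(0 : ℂ)}ᶜ,
      HasSum (fun j : ℕ => C j X κ * Z ^ j / (Nat.factorial j : ℂ))
        (Z * ee (X * (κ : ℂ)) * Complex.exp (X * Z) / (ee ((κ : ℝ) : ℂ) * Complex.exp Z - 1)))

include hC

lemma continuous_corr (k : ℕ) (μ : ℝ) (τ : ℂ) : Continuous fun X : ℝ => corr C (k : ℤ) X μ τ := by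
  simp_rw [corr_natCast C k]
  exact continuous_finsetSum _ fun j _ => (continuous_C hC j μ).const_mul _

lemma corr_one_sub_corr_zero (k : ℕ) (μ : ℝ) (τ : ℂ) :
    corr C (k : ℤ) 1 μ τ - corr C (k : ℤ) 0 μ τ = -I * (-2 * π) ^ k *
      (((bernoulli k : ℚ) : ℂ) / (Nat.factorial k : ℂ)) * τ ^ ((k : ℤ) - 1) := by
  rw [corr_natCast, corr_natCast, ← Finset.sum_sub_distrib]
  simp_rw [← mul_sub, C_one_sub_C_zero hC]
  rw [Finset.sum_eq_single 1]
  · rw [if_pos rfl, Nat.add_sub_cancel]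
    push_cast
    ring
  · intro j _ hj
    rw [if_neg hj, mul_zero]
  · intro h
    simp at h

lemma pairFun_zero_eq_one {k : ℕ} (hk : 2 ≤ k) (μ : ℝ) {τ : ℂ} (hτ : 0 < τ.re) :
    pairFun C k μ τ 0 = pairFun C k μ τ 1 := by
  have h1 := corr_one_sub_corr_zero hC k μ τ
  have h2 := tsum_geoPair_one_sub_zero (im_I_div_pos hτ) μ hk
  rw [eq_comm, ← sub_eq_zero, pairFun, pairFun]
  have h3 : (-I) ^ ((k : ℤ) - 1) * (-(2 * π * I)) ^ k = I * (-2 * π) ^ k := by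
    obtain ⟨m, rfl⟩ : ∃ m, k = m + 1 := ⟨k - 1, by omega⟩
    rw [show ((m + 1 : ℕ) : ℤ) - 1 = (m : ℤ) by simp, zpow_natCast,
      show -(2 * (π : ℂ) * I) = I * (-2 * π) by ring, mul_pow, pow_succ I, ← mul_assoc, ← mul_assoc,
      ← mul_pow, neg_mul, I_mul_I, neg_neg, one_pow, one_mul]
  rw [mul_zpow, Complex.ofReal_one, Complex.ofReal_zero]
  linear_combination h1 + (-I) ^ ((k : ℤ) - 1) * τ ^ ((k : ℤ) - 1) * h2 + τ ^ ((k : ℤ) - 1) *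
    (((bernoulli k : ℚ) : ℂ) / (Nat.factorial k : ℂ)) * h3

lemma continuousOn_pairFun {k : ℕ} (hk : 2 ≤ k) (μ : ℝ) {τ : ℂ} (hτ : 0 < τ.re) :
    ContinuousOn (pairFun C k μ τ) (Set.Icc 0 1) :=
  (continuous_corr hC k μ τ).continuousOn.add
    ((continuousOn_tsum_geoPair (im_I_div_pos hτ) μ hk).const_mul _)

lemma integral_corr (k : ℕ) (μ : ℝ) (τ : ℂ) (l : ℤ) :
    ∫ X in (0 : ℝ)..1, ee (-(l * X)) * corr C (k : ℤ) X μ τ =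
      ∑ j ∈ Finset.range (k + 2), ((-2 * (π : ℂ)) ^ k * (-I) ^ j *
      (((bernoulli (k + 1 - j) : ℚ) : ℂ) / (Nat.factorial (k + 1 - j) : ℂ)) *
        τ ^ ((k : ℤ) - (j : ℤ))) *
        ∫ X in (0 : ℝ)..1, ee (-(l * X)) * (C j X μ / (Nat.factorial j : ℂ)) := by
  have he : Continuous fun X : ℝ => ee (-(l * X)) := by
    simpa [neg_mul] using continuous_ee_mul (-l : ℂ)
  simp_rw [corr_natCast C k, Finset.mul_sum, ← intervalIntegral.integral_const_mul]
  rw [intervalIntegral.integral_finsetSum]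
  · refine Finset.sum_congr rfl fun j _ => ?_
    congr 1
    funext X
    ring
  · intro j _
    exact (he.mul ((continuous_C hC j μ).const_mul _)).intervalIntegrable _ _

lemma integral_pairFun {k : ℕ} (hk : 2 ≤ k) (μ : ℝ) {τ : ℂ} (hτ : 0 < τ.re) (l : ℤ) :
    ∫ X in (0 : ℝ)..1, ee (-(l * X)) * pairFun C k μ τ X =
      ((l : ℂ) - μ) ^ (-(k : ℤ)) * geoTerm 0 (I * τ * ((l : ℂ) - μ)) := by
  have h0 : τ ≠ 0 := by rintro rfl; simp at hτ
  have hpi : (π : ℂ) ≠ 0 := by exact_mod_cast Real.pi_ne_zero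
  have hσ := im_I_div_pos hτ
  have he : Continuous fun X : ℝ => ee (-(l * X)) := by
    simpa [neg_mul] using continuous_ee_mul (-l : ℂ)
  have h1 : ∫ X in (0 : ℝ)..1, ee (-(l * X)) * pairFun C k μ τ X =
      (∫ X in (0 : ℝ)..1, ee (-(l * X)) * corr C (k : ℤ) X μ τ) + (-I * τ) ^ ((k : ℤ) - 1) *
        ∫ X in (0 : ℝ)..1, ee (-(l * X)) * ∑' n, geoPair k (I / τ) μ n X := by
    rw [← intervalIntegral.integral_const_mul, ← intervalIntegral.integral_add]
    · refine intervalIntegral.integral_congr fun X _ => ?_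
      simp only [pairFun]
      ring
    · exact (he.mul (continuous_corr hC k μ τ)).intervalIntegrable _ _
    · refine ContinuousOn.intervalIntegrable ?_
      rw [Set.uIcc_of_le zero_le_one]
      exact (he.continuousOn.mul (continuousOn_tsum_geoPair hσ μ hk)).const_mul _
  rw [h1, integral_corr hC]
  have h2 := hasSum_integral_geoPair hσ μ hk l
  simp_rw [integral_geoPair hτ μ l] at h2
  obtain ⟨m, rfl⟩ : ∃ m, k = m + 1 := ⟨k - 1, by omega⟩
  have h6 : (-I * τ) ^ (((m + 1 : ℕ) : ℤ) - 1) * (τ / (2 * π) * (-(2 * π * I)) ^ (m + 2)) =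
      (-2 * π) ^ (m + 1) * τ ^ (m + 1) := by
    have h4 : (-I) ^ m * (-(2 * π * I)) ^ m = (-2 * π : ℂ) ^ m := by
      rw [← mul_pow]; congr 1; linear_combination 2 * π * I_sq
    have h5 : τ / (2 * π) * (-(2 * π * I)) ^ 2 = -2 * π * τ := by
      field_simp; linear_combination I_sq
    rw [show ((m + 1 : ℕ) : ℤ) - 1 = (m : ℤ) by simp, zpow_natCast, mul_pow, pow_add _ m 2,
      pow_succ _ m, pow_succ τ m, ← h4]
    linear_combination (-I) ^ m * (-(2 * π * I)) ^ m * τ ^ m * h5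
  by_cases hx : (l : ℂ) - μ = 0
  · have h3 : ∀ n, cotTermPow (m + 1) (I * τ * (l - μ)) n =
        (1 + (-1 : ℂ) ^ (m + 2)) * (((n : ℂ) + 1) ^ (m + 2))⁻¹ := by
      intro n
      rw [cotTermPow, hx, mul_zero, add_zero, sub_zero, pow_succ ((n : ℂ) + 1) (m + 1), mul_inv,
        pow_succ (-1 : ℂ) (m + 1)]
      ring
    simp_rw [h3] at h2
    rw [h2.unique ((hasSum_inv_pow_add_neg_one_pow (k := m + 2) (by omega)).mul_left _)]
    simp_rw [integral_C_of_eq hC hx]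
    rw [Finset.sum_eq_single 0 (fun j _ hj => by rw [if_neg hj, mul_zero]) (by simp), if_pos rfl,
      hx, zero_zpow _ (by omega), zero_mul]
    rw [Nat.sub_zero, pow_zero, Nat.cast_zero, sub_zero, zpow_natCast]
    linear_combination (((bernoulli (m + 2) : ℚ) : ℂ) / (Nat.factorial (m + 2) : ℂ)) * -h6
  · have hu : I * τ * ((l : ℂ) - μ) ∈ Complex.integerComplement := by
      rintro ⟨n, hn⟩
      have h3 := congrArg Complex.im hn
      rw [Complex.intCast_im, ← Complex.ofReal_intCast, ← Complex.ofReal_sub,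
        Complex.im_mul_ofReal] at h3
      simp only [Complex.mul_im, Complex.I_re, Complex.I_im, zero_mul, one_mul, zero_add] at h3
      rcases mul_eq_zero.mp h3.symm with h | h
      · exact hτ.ne' h
      · apply hx
        rw [← Complex.ofReal_intCast, ← Complex.ofReal_sub, h, Complex.ofReal_zero]
    rw [h2.unique ((hasSum_cotTermPow hu m).mul_left _)]
    simp_rw [integral_C_of_ne hC hx]
    rw [Finset.sum_range_succ', if_pos rfl, mul_zero, add_zero]
    set x : ℂ := (l : ℂ) - μ with hxdef
    set β : ℂ := 2 * π * I * (I * τ * x) with hβ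
    have hβ' : β = -2 * π * τ * x := by rw [hβ]; linear_combination 2 * π * τ * x * I_sq
    have h7 : ∀ j ∈ Finset.range (m + 1 + 1), ((-2 * (π : ℂ)) ^ (m + 1) * (-I) ^ (j + 1) *
        (((bernoulli (m + 1 + 1 - (j + 1)) : ℚ) : ℂ) /
          (Nat.factorial (m + 1 + 1 - (j + 1)) : ℂ)) *
        τ ^ (((m + 1 : ℕ) : ℤ) - ((j + 1 : ℕ) : ℤ))) *
        (if j + 1 = 0 then 0 else -(2 * π * I * x)⁻¹ ^ (j + 1)) =
        -((-2 * π) ^ (m + 1) * τ ^ (m + 1)) * ((β ^ (j + 1))⁻¹ *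
        (((bernoulli (m + 1 - j) : ℚ) : ℂ) / (Nat.factorial (m + 1 - j) : ℂ))) := by
      intro j _
      rw [if_neg (by omega), Nat.add_sub_add_right, zpow_sub₀ h0, zpow_natCast, zpow_natCast]
      have h8 : (-I) ^ (j + 1) * (τ ^ (j + 1))⁻¹ * (2 * π * I * x)⁻¹ ^ (j + 1) =
          (β ^ (j + 1))⁻¹ := by
        rw [← inv_pow, ← inv_pow, ← mul_pow, ← mul_pow, hβ']
        congr 1
        have hI := Complex.I_ne_zero
        field_simp
      rw [div_eq_mul_inv (τ ^ (m + 1))]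
      linear_combination (-(-2 * π) ^ (m + 1) * τ ^ (m + 1) *
        (((bernoulli (m + 1 - j) : ℚ) : ℂ) / (Nat.factorial (m + 1 - j) : ℂ))) * h8
    rw [Finset.sum_congr rfl h7, ← Finset.mul_sum]
    rw [show τ / (2 * π) * ((-(2 * π * I)) ^ (m + 2) * cotValPow (m + 1) β) =
      τ / (2 * π) * (-(2 * π * I)) ^ (m + 2) * cotValPow (m + 1) β by ring, ← mul_assoc, h6,
      cotValPow]
    have h9 : ((-2 * π) ^ (m + 1) * τ ^ (m + 1)) * (β ^ (m + 1))⁻¹ = x ^ (-((m + 1 : ℕ) : ℤ)) := by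
      rw [zpow_neg, zpow_natCast, ← inv_pow, ← inv_pow, ← mul_pow, ← mul_pow, hβ']
      congr 1
      field_simp
    rw [← h9, geoTerm, Complex.ofReal_zero, zero_mul, ee_zero, ee_eq_exp (I * τ * x), ← hβ]
    ring

end gen

lemma neg_one_zpow_natCast_sub_one (k : ℕ) : (-1 : ℂ) ^ ((k : ℤ) - 1) = -(-1) ^ k := by
  rw [zpow_sub₀ (by norm_num), zpow_natCast, zpow_one, div_neg, div_one]

lemma hasSum_inv_succ_pow_zeta {k : ℕ} (hk : 2 ≤ k) :
    HasSum (fun n : ℕ => (((n : ℂ) + 1) ^ k)⁻¹) (riemannZeta k) := by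
  have h1 : Summable fun n : ℕ => 1 / (n : ℂ) ^ k := by
    simpa using Complex.summable_one_div_nat_cpow (p := (k : ℂ)).mpr (by
      rw [Complex.natCast_re]; exact_mod_cast hk)
  have h2 := (hasSum_nat_add_iff' 1).mpr h1.hasSum
  rw [← zeta_nat_eq_tsum_of_gt_one (by omega)] at h2
  have hk0 : k ≠ 0 := by omega
  simpa [hk0] using h2

lemma hasSum_geoPair_fract {k : ℕ} (hk : 2 ≤ k) (α μ : ℝ) {τ : ℂ} (hτ : 0 < τ.re) :
    HasSum (fun n => geoPair k (I / τ) μ n (Int.fract α))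
      (dInt α * riemannZeta ((k : ℤ) : ℂ) + Scal ((k : ℤ) : ℂ) α 0 μ 0 (1 / τ) +
          (-1 : ℂ) ^ ((k : ℤ) - 1) * Scal ((k : ℤ) : ℂ) (-α) 0 (-μ) 0 (1 / τ)) := by
  have hσ := im_I_div_pos hτ
  have ht : 0 < (1 / τ).re := by
    have : (1 / τ).re = (I / τ).im := by rw [div_eq_mul_inv, div_eq_mul_inv]; simp
    rwa [this]
  have h1 := hasSum_Scal_geoTerm k α 0 μ 0 ht
  have h2 := (hasSum_Scal_geoTerm k (-α) 0 (-μ) 0 ht).mul_left ((-1 : ℂ) ^ ((k : ℤ) - 1))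
  have h3 := (hasSum_inv_succ_pow_zeta hk).mul_left (dInt α)
  rw [show ((k : ℤ) : ℂ) = (k : ℂ) by simp] at h1 h2 ⊢
  refine ((h3.add h1).add h2).congr_fun fun n => ?_
  have e1 : ((fracP 0 + n : ℝ) : ℂ) = (n : ℂ) + 1 := by rw [fracP_zero]; push_cast; ring
  have e2 : I * (1 / τ) = I / τ := by rw [mul_one_div]
  have e3 : fracP (-α) = 1 - Int.fract α := by rw [fracP, neg_neg]
  have e4 : dInt α + geoTerm (fracP α) (μ + I / τ * (n + 1)) =
      geoTerm (Int.fract α) (μ + I / τ * (n + 1)) := by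
    rcases dInt_eq_zero_or α with ⟨h, h', h''⟩ | ⟨h, h', -⟩
    · rw [h, h', h'']
      linear_combination geoTerm_one_sub_geoTerm_zero (one_sub_ee_add_ne_zero hσ μ n)
    · rw [h, h', zero_add]
  have e5 := geoTerm_add_geoTerm_neg_of_add_eq_one
    (show Int.fract α + (1 - Int.fract α) = 1 by ring) (μ - I / τ * (n + 1))
  rw [e1, e2, e3, mul_zero, Complex.ofReal_zero, ee_zero, zpow_neg, zpow_natCast,
    neg_one_zpow_natCast_sub_one, geoPair, ← e4, Complex.ofReal_neg,
    show -(μ : ℂ) + I / τ * (n + 1) = -(μ - I / τ * (n + 1)) by ring]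
  linear_combination (((n : ℂ) + 1) ^ k)⁻¹ * (-1) ^ k * e5

lemma hasSum_int_of_posTranslate {G : ℝ → ℂ} (hG : G 0 = 0) (μ : ℝ) {a b : ℂ}
    (ha : HasSum (fun i : ℕ => G (fracP (-μ) + i)) a)
    (hb : HasSum (fun i : ℕ => G (-(fracP μ + i))) b) :
    HasSum (fun l : ℤ => G (l - μ)) (a + b) := by
  set s : Set ℤ := {l | 0 < -μ + (l : ℝ)} with hs
  set t : Set ℤ := {l | -μ + (l : ℝ) < 0} with ht
  have hst : Disjoint s t := Set.disjoint_left.mpr fun l h1 h2 => by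
    rw [hs, Set.mem_ofPred_eq] at h1
    rw [ht, Set.mem_ofPred_eq] at h2
    exact lt_asymm h1 h2
  have h1 : HasSum ((fun l : ℤ => G (l - μ)) ∘ (fun l : s => (l : ℤ))) a := by
    rw [← ((posTranslateEquiv (-μ)).trans (Equiv.subtypeEquivRight fun l => by
      rw [hs, Set.mem_ofPred_eq])).hasSum_iff]
    refine ha.congr_fun fun i => ?_
    rw [← posTranslateEquiv_apply (-μ) i]
    simp only [Function.comp_apply, Equiv.trans_apply, Equiv.subtypeEquivRight_apply_coe]
    congr 1
    ring
  have h2 : HasSum ((fun l : ℤ => G (l - μ)) ∘ (fun l : t => (l : ℤ))) b := by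
    rw [← ((posTranslateEquiv μ).trans ((Equiv.neg ℤ).subtypeEquiv fun n => by
      rw [ht, Set.mem_ofPred_eq, Equiv.neg_apply]
      push_cast
      constructor <;> intro h <;> linarith)).hasSum_iff]
    refine hb.congr_fun fun i => ?_
    rw [← posTranslateEquiv_apply μ i]
    simp only [Function.comp_apply, Equiv.trans_apply, Equiv.subtypeEquiv_apply, Equiv.neg_apply]
    congr 1
    push_cast
    ring
  rw [← hasSum_subtype_iff_of_support_subset (s := s ∪ t)]
  · exact h1.add_disjoint hst h2
  · intro l hl
    by_contra h
    rw [hs, ht, Set.mem_union, Set.mem_ofPred_eq, Set.mem_ofPred_eq, not_or, not_lt, not_lt] at h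
    apply hl
    simp only
    rw [show (l : ℝ) - μ = 0 by linarith, hG]

lemma hasSum_psiIntC (C : ℕ → ℂ → ℝ → ℂ) {k : ℕ} (hk : 2 ≤ k) (γ κ : ℝ) :
    HasSum (fun i : ℕ => ee (((fracP γ + i) * κ : ℝ) : ℂ) * ((fracP γ + i : ℝ) : ℂ) ^ (-(k : ℤ)))
      (psiIntC C k γ κ) := by
  rw [psiIntC, if_pos (by exact_mod_cast hk),
    tsum_posTranslate γ fun x => ee ((x * κ : ℝ) : ℂ) * (x : ℂ) ^ (-(k : ℤ))]
  refine Summable.hasSum (Summable.of_norm ?_)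
  refine ((Real.summable_one_div_nat_add_rpow (fracP γ) k).mpr (by exact_mod_cast hk)).congr
    fun i => ?_
  rw [norm_mul, norm_ee_ofReal, one_mul, norm_zpow, Complex.norm_real, Real.rpow_natCast,
    zpow_neg, zpow_natCast, one_div, add_comm, Real.norm_eq_abs]

lemma hasSum_int_psiIntC (C : ℕ → ℂ → ℝ → ℂ) {k : ℕ} (hk : 2 ≤ k) (α μ : ℝ) {τ : ℂ}
    (hτ : 0 < τ.re) :
    HasSum (fun l : ℤ => ee (((l - μ) * α : ℝ) : ℂ) * (((l : ℂ) - μ) ^ (-(k : ℤ)) *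
        geoTerm 0 (I * τ * ((l : ℂ) - μ))))
      (psiIntC C k (-μ) α + Scal ((k : ℤ) : ℂ) 0 (-μ) 0 α τ +
            (-1 : ℂ) ^ ((k : ℤ) - 1) * Scal ((k : ℤ) : ℂ) 0 μ 0 (-α) τ) := by
  have hne : ∀ {x : ℝ}, 0 < x → 1 - ee (I * τ * x) ≠ 0 := fun hx => by
    refine one_sub_ee_ne_zero_of_im_ne_zero ?_
    rw [Complex.im_mul_ofReal]
    simpa using ⟨hτ.ne', hx.ne'⟩
  have hpos : ∀ (γ : ℝ) (i : ℕ), 0 < fracP γ + i := fun γ i => by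
    have := fracP_pos γ; positivity
  have h := hasSum_int_of_posTranslate (G := fun x => ee ((x * α : ℝ) : ℂ) *
    ((x : ℂ) ^ (-(k : ℤ)) * geoTerm 0 (I * τ * x)))
    (a := psiIntC C k (-μ) α + Scal ((k : ℤ) : ℂ) 0 (-μ) 0 α τ)
    (b := (-1 : ℂ) ^ ((k : ℤ) - 1) * Scal ((k : ℤ) : ℂ) 0 μ 0 (-α) τ) ?_ μ ?_ ?_
  · refine h.congr_fun fun l => ?_
    push_cast
    rfl
  · simp only [Complex.ofReal_zero, zero_zpow (-(k : ℤ)) (by omega), zero_mul, mul_zero]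
  · refine ((hasSum_psiIntC C hk (-μ) α).add (hasSum_Scal_geoTerm k 0 (-μ) 0 α hτ)).congr_fun
      fun i => ?_
    have h1 := geoTerm_one_sub_geoTerm_zero (hne (hpos (-μ) i))
    rw [fracP_zero, Complex.ofReal_zero, zero_add]
    linear_combination (-ee (((fracP (-μ) + i) * α : ℝ) : ℂ) *
      ((fracP (-μ) + i : ℝ) : ℂ) ^ (-(k : ℤ))) * h1
  · refine ((hasSum_Scal_geoTerm k 0 μ 0 (-α) hτ).mul_left _).congr_fun fun i => ?_
    have h1 := geoTerm_add_geoTerm_neg_of_add_eq_one (show (1 : ℝ) + 0 = 1 by ring)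
      (I * τ * ((fracP μ + i : ℝ) : ℂ))
    rw [fracP_zero, Complex.ofReal_zero, zero_add, neg_one_zpow_natCast_sub_one, neg_mul_comm,
      Complex.ofReal_neg (fracP μ + i), mul_neg (I * τ),
      neg_eq_neg_one_mul ((fracP μ + i : ℝ) : ℂ), mul_zpow,
      show (-1 : ℂ) ^ (-(k : ℤ)) = (-1) ^ k by
        rw [zpow_neg, zpow_natCast, ← inv_pow, inv_neg, inv_one]]
    linear_combination (ee (((fracP μ + i) * -α : ℝ) : ℂ) * (-1) ^ k *
      ((fracP μ + i : ℝ) : ℂ) ^ (-(k : ℤ))) * h1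

section gen

variable {C : ℕ → ℂ → ℝ → ℂ}
    (hC : ∀ (X : ℂ) (κ : ℝ), ∀ᶠ Z in nhdsWithin (0 : ℂ) {(0 : ℂ)}ᶜ,
      HasSum (fun j : ℕ => C j X κ * Z ^ j / (Nat.factorial j : ℂ))
        (Z * ee (X * (κ : ℂ)) * Complex.exp (X * Z) / (ee ((κ : ℝ) : ℂ) * Complex.exp Z - 1)))

include hC

/-- The transformation formula of the pair `ψ(k)`, `ζ(k)` for `k ≥ 2`. -/
theorem transformation_pos (α μ : ℝ) {τ : ℂ} (hτ : 0 < τ.re) {k : ℕ} (hk : 2 ≤ k) :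
    ee ((α * μ : ℝ) : ℂ) *
          (psiIntC C k (-μ) α + Scal ((k : ℤ) : ℂ) 0 (-μ) 0 α τ +
            (-1 : ℂ) ^ ((k : ℤ) - 1) * Scal ((k : ℤ) : ℂ) 0 μ 0 (-α) τ) -
        corr C k ((Int.fract α : ℝ) : ℂ) μ τ =
      (-Complex.I * τ) ^ ((k : ℤ) - 1) *
        (dInt α * riemannZeta ((k : ℤ) : ℂ) + Scal ((k : ℤ) : ℂ) α 0 μ 0 (1 / τ) +
          (-1 : ℂ) ^ ((k : ℤ) - 1) * Scal ((k : ℤ) : ℂ) (-α) 0 (-μ) 0 (1 / τ)) := by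
  have h1 := (hasSum_int_psiIntC C hk α μ hτ).mul_left (ee ((α * μ : ℝ) : ℂ))
  have h2 : HasSum (fun l : ℤ => (((l : ℂ) - μ) ^ (-(k : ℤ)) *
      geoTerm 0 (I * τ * ((l : ℂ) - μ))) * ee (l * (Int.fract α : ℝ))) _ :=
    h1.congr_fun fun l => by
      have : ee ((α * μ : ℝ) : ℂ) * ee (((l - μ) * α : ℝ) : ℂ) = ee (l * (Int.fract α : ℝ)) := by
        rw [← ee_add, Int.fract, ← ee_sub_intCast _ (l * ⌊α⌋)]
        congr 1
        push_cast
        ring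
      rw [← this]
      ring
  have hs : Summable fun l : ℤ => ((l : ℂ) - μ) ^ (-(k : ℤ)) *
      geoTerm 0 (I * τ * ((l : ℂ) - μ)) := by
    refine Summable.of_norm (h2.summable.norm.congr fun l => ?_)
    rw [norm_mul _ (ee _), show (l : ℂ) * (Int.fract α : ℝ) = ((l * Int.fract α : ℝ) : ℂ) by
      push_cast; ring, norm_ee_ofReal, mul_one]
  have h3 := hasSum_fourier_of_integral (continuousOn_pairFun hC hk μ hτ)
    (pairFun_zero_eq_one hC hk μ hτ) (integral_pairFun hC hk μ hτ) hs
    (x := Int.fract α) ⟨Int.fract_nonneg α, Int.fract_lt_one α⟩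
  rw [h2.unique h3, pairFun, (hasSum_geoPair_fract hk α μ hτ).tsum_eq, add_sub_cancel_left]

end gen

/-- Corollary 4.3 of the paper: the pairing of `ψ(k,-μ,α)` and `ζ(k)`. -/
theorem statement6 (α μ : ℝ) (k : ℤ) (hk : k ≠ 1) (τ : ℂ) (hτ : 0 < τ.re)
    (C : ℕ → ℂ → ℝ → ℂ)
    (hC : ∀ (X : ℂ) (κ : ℝ), ∀ᶠ Z in nhdsWithin (0 : ℂ) {(0 : ℂ)}ᶜ,
      HasSum (fun j : ℕ => C j X κ * Z ^ j / (Nat.factorial j : ℂ))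
        (Z * ee (X * (κ : ℂ)) * Complex.exp (X * Z) / (ee ((κ : ℝ) : ℂ) * Complex.exp Z - 1))) :
    ee ((α * μ : ℝ) : ℂ) *
          (psiIntC C k (-μ) α + Scal (k : ℂ) 0 (-μ) 0 α τ +
            (-1 : ℂ) ^ (k - 1) * Scal (k : ℂ) 0 μ 0 (-α) τ) -
        (-2 * (Real.pi : ℂ)) ^ k *
          ∑ j ∈ Finset.range (k + 2).toNat,
            (-Complex.I) ^ j * C j ((Int.fract α : ℝ) : ℂ) μ *
                ((bernoulli ((k + 1).toNat - j) : ℚ) : ℂ) /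
                ((Nat.factorial j : ℂ) * (Nat.factorial ((k + 1).toNat - j) : ℂ)) *
              τ ^ (k - (j : ℤ)) =
      (-Complex.I * τ) ^ (k - 1) *
        (dInt α * riemannZeta ((k : ℤ) : ℂ) + Scal (k : ℂ) α 0 μ 0 (1 / τ) +
          (-1 : ℂ) ^ (k - 1) * Scal (k : ℂ) (-α) 0 (-μ) 0 (1 / τ)) := by
  rcases le_or_gt k 0 with h | h
  · obtain ⟨K, hK⟩ := Int.eq_ofNat_of_zero_le (neg_nonneg.mpr h)
    obtain rfl : k = -(K : ℤ) := by omega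
    exact transformation_neg hC α μ hτ K
  · obtain ⟨n, rfl⟩ := Int.eq_ofNat_of_zero_le h.le
    exact transformation_pos hC α μ hτ (by omega)

end
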